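/- arXiv:1208.2185 — 2 statements merged into one kernel-verified Lean document; each statement's English description precedes it below -/
import Mathlib

section
/- T(F) is exactly the T-ideal generated by the three polynomials [[t1,t2][t3,t4],t5], [t1,t2][t3,t4][t5,t6], and s4(t1,t2,t3,t4); that is, these three polynomials form a basis of the polynomial identities of the algebra F. -/
open scoped TensorProduct

noncomputable section

/-- The free supercommutative algebra on four even variables `x1, x2, x1', x2'` and four odd
variables `y1, y2, y1', y2'`: the tensor product of a polynomial ring in four variables with
the exterior algebra on a four-dimensional space. -/
abbrev FreeSuperComm (K : Type*) [Field K] :=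
  (MvPolynomial (Fin 4) K) ⊗[K] (ExteriorAlgebra K (Fin 4 → K))

/-- The even generators: `xg K 0 = x1`, `xg K 1 = x1'`, `xg K 2 = x2`, `xg K 3 = x2'`. -/
def xg (K : Type*) [Field K] (i : Fin 4) : FreeSuperComm K :=
  (MvPolynomial.X i) ⊗ₜ[K] 1

/-- The odd generators: `yg K 0 = y1`, `yg K 1 = y1'`, `yg K 2 = y2`, `yg K 3 = y2'`. -/
def yg (K : Type*) [Field K] (i : Fin 4) : FreeSuperComm K :=
  1 ⊗ₜ[K] (ExteriorAlgebra.ι K (Pi.single i 1))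

/-- The generic matrix `C1 = (x1, y1; y1', x1')`. -/
def genC₁ (K : Type*) [Field K] : Matrix (Fin 2) (Fin 2) (FreeSuperComm K) :=
  !![xg K 0, yg K 0; yg K 1, xg K 1]

/-- The generic matrix `C2 = (x2, y2; y2', x2')`. -/
def genC₂ (K : Type*) [Field K] : Matrix (Fin 2) (Fin 2) (FreeSuperComm K) :=
  !![xg K 2, yg K 2; yg K 3, xg K 3]

/-- `F = K[C1, C2]`, the unital subalgebra generated by the two generic matrices. -/
def Falg (K : Type*) [Field K] : Subalgebra K (Matrix (Fin 2) (Fin 2) (FreeSuperComm K)) :=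
  Algebra.adjoin K {genC₁ K, genC₂ K}

/-- The commutator `[a,b] = a*b - b*a`. -/
def br {A : Type*} [Ring A] (a b : A) : A := a * b - b * a

/-- `adIter c l z` is the left-normed commutator `[z, c^{(l)}] = [z, c, ..., c]`
with `l` occurrences of `c`. -/
def adIter {A : Type*} [Ring A] (c : A) (l : ℕ) (z : A) : A :=
  (fun w => w * c - c * w)^[l] z

/-- The free generators of the free unital associative algebra `K⟨t1, t2, ...⟩`;
`tv K i` corresponds to `t_{i+1}`. -/
def tv (K : Type*) [Field K] (i : ℕ) : FreeAlgebra K ℕ := FreeAlgebra.ι K i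

/-- The standard polynomial `s4(t1,t2,t3,t4)`. -/
def s4poly (K : Type*) [Field K] : FreeAlgebra K ℕ :=
  ∑ σ : Equiv.Perm (Fin 4), (Equiv.Perm.sign σ : ℤ) •
    (tv K (σ 0) * tv K (σ 1) * tv K (σ 2) * tv K (σ 3))

/-- The polynomial `[[t1,t2][t3,t4],t5]`. -/
def p₁ (K : Type*) [Field K] : FreeAlgebra K ℕ :=
  br (br (tv K 0) (tv K 1) * br (tv K 2) (tv K 3)) (tv K 4)

/-- The polynomial `[t1,t2][t3,t4][t5,t6]`. -/
def p₂ (K : Type*) [Field K] : FreeAlgebra K ℕ :=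
  br (tv K 0) (tv K 1) * br (tv K 2) (tv K 3) * br (tv K 4) (tv K 5)

/-- The T-ideal of `K⟨t1, t2, ...⟩` generated by a set `S`: the two-sided ideal generated by
all images of elements of `S` under unital `K`-algebra endomorphisms of the free algebra. -/
def TIdealGen (K : Type*) [Field K] (S : Set (FreeAlgebra K ℕ)) :
    TwoSidedIdeal (FreeAlgebra K ℕ) :=
  TwoSidedIdeal.span
    {g | ∃ f ∈ S, ∃ φ : FreeAlgebra K ℕ →ₐ[K] FreeAlgebra K ℕ, g = φ f}

/-- `T(A)`: the set of polynomial identities of a unital associative `K`-algebra `A`, i.e. all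
elements of the free algebra `K⟨t1, t2, ...⟩` killed by every unital `K`-algebra
homomorphism into `A`. -/
def polyIdentities (K : Type*) [Field K] (A : Type*) [Ring A] [Algebra K A] :
    Set (FreeAlgebra K ℕ) :=
  {f | ∀ φ : FreeAlgebra K ℕ →ₐ[K] A, φ f = 0}

noncomputable section SecKoz
set_option linter.unusedSectionVars false
open MvPolynomial

namespace KZ
variable {K : Type*} [Field K] {ι : Type*} [Fintype ι] [DecidableEq ι]

abbrev PP (K : Type*) [Field K] (ι : Type*) := MvPolynomial (ι ⊕ ι) K
def xx (K : Type*) [Field K] {ι : Type*} (i : ι) : PP K ι := X (Sum.inl i)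
def XX (K : Type*) [Field K] {ι : Type*} (i : ι) : PP K ι := X (Sum.inr i)
def dd (K : Type*) [Field K] {ι : Type*} (i : ι) : Derivation K (PP K ι) (PP K ι) := pderiv (Sum.inr i)

lemma dd_XX (i j : ι) : dd K i (XX K j) = if i = j then 1 else 0 := by
  simp [dd, XX, pderiv_X, Pi.single_apply, eq_comm]

lemma dd_comm (i j : ι) (p : PP K ι) : dd K i (dd K j p) = dd K j (dd K i p) := by
  have h : ⁅dd K i, dd K j⁆ = (0 : Derivation K (PP K ι) (PP K ι)) := by
    apply MvPolynomial.derivation_ext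
    intro k
    rw [Derivation.commutator_apply]
    simp only [dd, pderiv_X, Pi.single_apply]
    split_ifs <;> simp
  have := congrArg (fun D => D p) h
  simp only [Derivation.commutator_apply] at this
  exact sub_eq_zero.1 (by simpa using this)

/-- eigenvector of the Euler operator -/
def Eul (e : K) (p : PP K ι) : Prop := ∑ i, XX K i * dd K i p = e • p

lemma Eul_dd {e : K} {p : PP K ι} (h : Eul e p) (k : ι) : Eul (e - 1) (dd K k p) := by
  unfold Eul at *
  have h2 := congrArg (dd K k) h
  simp only [map_sum, Derivation.leibniz, dd_XX, Derivation.map_smul, Finset.sum_add_distrib,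
    smul_eq_mul, mul_ite, mul_one, mul_zero, Finset.sum_ite_eq, Finset.mem_univ, if_true] at h2
  rw [sub_smul, one_smul, ← h2]
  simp [dd_comm k]

lemma Eul2 {e : K} {p : PP K ι} (h : Eul e p) :
    ∑ i, ∑ k, XX K i * (XX K k * dd K i (dd K k p)) = (e * (e - 1)) • p := by
  rw [Finset.sum_comm]
  have : ∀ k, ∑ i, XX K i * (XX K k * dd K i (dd K k p)) = (e-1) • (XX K k * dd K k p) := by
    intro k
    have := Eul_dd h k
    unfold Eul at this
    rw [← mul_smul_comm, ← this, Finset.mul_sum]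
    exact Finset.sum_congr rfl fun i _ => by ring
  simp only [this, ← Finset.smul_sum]
  unfold Eul at h
  rw [h, smul_smul, mul_comm]

variable {W : Type*} [AddCommGroup W] [Module K W]

lemma lem1 (M : ι → ι → PP K ι →ₗ[K] W) (anti : ∀ a b p, M a b p = - M b a p)
    (J : ∀ k a b p, M a b (XX K k * p) = M k b (XX K a * p) - M k a (XX K b * p))
    {e : K} {p : PP K ι} (h : Eul e p) (a b : ι) :
    ∑ i, M i b (dd K i (p * XX K a)) - ∑ i, M i a (dd K i (p * XX K b)) = (2 + e) • M a b p := by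
  have key : ∀ (L : ι → PP K ι →ₗ[K] W) (a : ι), ∑ i, L i (dd K i (p * XX K a))
      = L a p + ∑ i, L i (XX K a * dd K i p) := by
    intro L a
    simp only [Derivation.leibniz, dd_XX, smul_eq_mul, mul_ite, mul_one, mul_zero, map_add,
      Finset.sum_add_distrib]
    congr 1
    rw [Finset.sum_eq_single a] <;> simp +contextual
  rw [key, key]
  have h3 : ∑ i, M i b (XX K a * dd K i p) - ∑ i, M i a (XX K b * dd K i p) = e • M a b p := by
    rw [← Finset.sum_sub_distrib, ← map_smul, ← h, map_sum]
    exact Finset.sum_congr rfl fun i _ => (J i a b _).symm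
  rw [anti b a p]
  linear_combination (norm := module) h3

lemma key2 (L : ι → ι → PP K ι →ₗ[K] W) (p : PP K ι) (a c : ι) :
    ∑ i, ∑ k, L i k (dd K i (dd K k (p * (XX K a * XX K c)))) =
      ∑ i, ∑ k, L i k (XX K a * (XX K c * dd K i (dd K k p)))
      + ∑ i, L i a (XX K c * dd K i p) + ∑ i, L i c (XX K a * dd K i p)
      + ∑ k, L a k (XX K c * dd K k p) + ∑ k, L c k (XX K a * dd K k p)
      + L a c p + L c a p := by
  have e : ∀ i k, dd K i (dd K k (p * (XX K a * XX K c))) =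
      XX K a * (XX K c * dd K i (dd K k p)) + (if k = a then XX K c * dd K i p else 0)
      + (if k = c then XX K a * dd K i p else 0) + (if i = a then XX K c * dd K k p else 0)
      + (if i = c then XX K a * dd K k p else 0)
      + (if i = a then if k = c then p else 0 else 0)
      + (if i = c then if k = a then p else 0 else 0) := by
    intro i k
    simp only [Derivation.leibniz, dd_XX, smul_eq_mul, map_add]
    split_ifs <;> simp <;> ring
  simp only [e, map_add, Finset.sum_add_distrib, apply_ite (L _ _), map_zero, Finset.sum_ite_eq',
    Finset.mem_univ, if_true, Finset.sum_ite_irrel, Finset.sum_const_zero]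

lemma lem2 (M : ι → ι → ι → ι → PP K ι →ₗ[K] W)
    (anti1 : ∀ a b c d p, M a b c d p = - M b a c d p)
    (anti2 : ∀ a b c d p, M a b c d p = - M a b d c p)
    (J1 : ∀ k a b c d p, M a b c d (XX K k * p) = M k b c d (XX K a * p) - M k a c d (XX K b * p))
    (J2 : ∀ k a b c d p, M a b c d (XX K k * p) = M a b k d (XX K c * p) - M a b k c (XX K d * p))
    (S : ∀ a b c d p, M a b c d p + M c d a b p - M a c b d p - M b d a c p
       + M a d b c p + M b c a d p = 0)
    {e : K} {p : PP K ι} (h : Eul e p) (a b c d : ι) :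
    ∑ i, ∑ k, M i b k d (dd K i (dd K k (p * (XX K a * XX K c))))
    - ∑ i, ∑ k, M i a k d (dd K i (dd K k (p * (XX K b * XX K c))))
    - ∑ i, ∑ k, M i b k c (dd K i (dd K k (p * (XX K a * XX K d))))
    + ∑ i, ∑ k, M i a k c (dd K i (dd K k (p * (XX K b * XX K d))))
     = (e ^ 2 + 5 * e + 5) • M a b c d p + M c d a b p := by
  rw [key2 (fun i k => M i b k d), key2 (fun i k => M i a k d), key2 (fun i k => M i b k c),
    key2 (fun i k => M i a k c)]
  have E1 : ∀ a b c d, ∑ i, M a b c d (XX K i * dd K i p) = e • M a b c d p := by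
    intro a b c d
    rw [← map_smul, ← h, map_sum]
  have h1 : ∑ i, ∑ k, M i b k d (XX K a * (XX K c * dd K i (dd K k p)))
    - ∑ i, ∑ k, M i a k d (XX K b * (XX K c * dd K i (dd K k p)))
    - ∑ i, ∑ k, M i b k c (XX K a * (XX K d * dd K i (dd K k p)))
    + ∑ i, ∑ k, M i a k c (XX K b * (XX K d * dd K i (dd K k p)))
    = (e * (e-1)) • M a b c d p := by
    rw [← map_smul, ← Eul2 h]
    simp only [map_sum, ← Finset.sum_sub_distrib, ← Finset.sum_add_distrib]
    refine Finset.sum_congr rfl fun i _ => Finset.sum_congr rfl fun k _ => ?_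
    rw [J1 i a b c d, mul_left_comm (XX K a) (XX K k), mul_left_comm (XX K b) (XX K k), J2 k i b c d,
      J2 k i a c d]
    simp only [mul_left_comm (XX K c) (XX K _), mul_left_comm (XX K d) (XX K _)]
    module
  have h2 : ∑ i, M i b c d (XX K a * dd K i p) - ∑ i, M i a c d (XX K b * dd K i p)
     - ∑ i, M i b d c (XX K a * dd K i p) + ∑ i, M i a d c (XX K b * dd K i p)
     = (2 * e) • M a b c d p := by
    rw [mul_smul, ← E1, Finset.smul_sum]
    simp only [← Finset.sum_sub_distrib, ← Finset.sum_add_distrib]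
    refine Finset.sum_congr rfl fun i _ => ?_
    rw [J1 i a b c d, anti2 i b d c, anti2 i a d c]
    module
  have h2' : ∑ k, M a b k d (XX K c * dd K k p) - ∑ k, M b a k d (XX K c * dd K k p)
     - ∑ k, M a b k c (XX K d * dd K k p) + ∑ k, M b a k c (XX K d * dd K k p)
     = (2 * e) • M a b c d p := by
    rw [mul_smul, ← E1, Finset.smul_sum]
    simp only [← Finset.sum_sub_distrib, ← Finset.sum_add_distrib]
    refine Finset.sum_congr rfl fun i _ => ?_
    rw [J2 i a b c d, anti1 b a i c, anti1 b a i d]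
    module
  have h3 : ∑ i, M i b a d (XX K c * dd K i p) - ∑ i, M i a b d (XX K c * dd K i p)
     - ∑ i, M i b a c (XX K d * dd K i p) + ∑ i, M i a b c (XX K d * dd K i p)
     = e • M a b c d p := by
    rw [← E1]
    simp only [← Finset.sum_sub_distrib, ← Finset.sum_add_distrib]
    refine Finset.sum_congr rfl fun i _ => ?_
    rw [J1 i a b c d, J2 c i b a d, J2 c i a b d, anti2 i b c a, anti2 i a c b]
    module
  have h3' : ∑ k, M c b k d (XX K a * dd K k p) - ∑ k, M c a k d (XX K b * dd K k p)
     - ∑ k, M d b k c (XX K a * dd K k p) + ∑ k, M d a k c (XX K b * dd K k p)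
     = e • M a b c d p := by
    rw [← E1]
    simp only [← Finset.sum_sub_distrib, ← Finset.sum_add_distrib]
    refine Finset.sum_congr rfl fun i _ => ?_
    rw [J2 i a b c d, J1 c a b i d, J1 d a b i c]
    module
  have h4 := S a b c d p
  have a1 := anti1 b a c d p
  have a2 := anti2 a b d c p
  have a3 := anti1 b a d c p
  have b1 := anti1 c b a d p
  have b2 := anti1 c a b d p
  have b3 := anti1 d b a c p
  have b4 := anti1 d a b c p
  linear_combination (norm := module) h1 + h2 + h2' + h3 + h3' - h4 - a1 - a2 + a3 + b1 - b2 - b3 + b4 -a2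


def wt (m : ι ⊕ ι →₀ ℕ) : ℕ := ∑ i, m (Sum.inr i)

def Del (r : ℕ → K) : PP K ι →ₗ[K] PP K ι :=
  (basisMonomials (ι ⊕ ι) K).constr K (fun m => r (wt m) • monomial m (1 : K))

lemma Del_mono (r : ℕ → K) (m : ι ⊕ ι →₀ ℕ) (c : K) :
    Del r (monomial m c) = r (wt m) • monomial m c := by
  have h : (monomial m c : PP K ι) = c • (basisMonomials (ι ⊕ ι) K m) := by
    simp [coe_basisMonomials, smul_monomial]
  rw [h, map_smul, Del, Module.Basis.constr_basis]
  simp [coe_basisMonomials, smul_monomial, mul_comm]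

lemma Eul_mono (m : ι ⊕ ι →₀ ℕ) (c : K) : Eul (wt m : K) (monomial m c : PP K ι) := by
  unfold Eul
  simp only [XX, dd, X_mul_pderiv_monomial, wt, ← Finset.sum_smul]
  rw [Nat.cast_smul_eq_nsmul]

lemma mono_mul (m : ι ⊕ ι →₀ ℕ) (c : K) (a : ι) :
    (monomial m c * XX K a : PP K ι) = monomial (m + Finsupp.single (Sum.inr a) 1) c := by
  simp [XX, X, monomial_mul]

lemma wt_add (m : ι ⊕ ι →₀ ℕ) (a : ι) : wt (m + Finsupp.single (Sum.inr a) 1) = wt m + 1 := by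
  simp [wt, Finset.sum_add_distrib, Finsupp.single_apply]

lemma Del_mul (r : ℕ → K) (m : ι ⊕ ι →₀ ℕ) (c : K) (a : ι) :
    Del r (monomial m c * XX K a) = r (wt m + 1) • (monomial m c * XX K a) := by
  rw [mono_mul, Del_mono, wt_add]

lemma Del_mul2 (r : ℕ → K) (m : ι ⊕ ι →₀ ℕ) (c : K) (a b : ι) :
    Del r (monomial m c * (XX K a * XX K b)) = r (wt m + 2) • (monomial m c * (XX K a * XX K b)) := by
  rw [← mul_assoc, mono_mul, Del_mul, wt_add]

def dl (K : Type*) [Field K] {ι : Type*} [DecidableEq ι] (i j : ι) : PP K ι := if i = j then 1 else 0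

def ee (K : Type*) [Field K] {ι : Type*} [DecidableEq ι] (a b j : ι) : PP K ι :=
  XX K a * dl K b j - XX K b * dl K a j

theorem inj1 [CharZero K] (M : ι → ι → PP K ι →ₗ[K] W) (anti : ∀ a b p, M a b p = - M b a p)
    (J : ∀ k a b p, M a b (XX K k * p) = M k b (XX K a * p) - M k a (XX K b * p))
    (z : ι → ι → PP K ι) (hz : ∀ j, ∑ a, ∑ b, z a b * ee K a b j = 0) :
    ∑ a, ∑ b, M a b (z a b) = 0 := by
  let r : ℕ → K := fun d => ((d : K) + 1)⁻¹
  let Ψ : (ι → PP K ι) →ₗ[K] W :=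
    ∑ j, ∑ i, (M i j) ∘ₗ (dd K i).toLinearMap ∘ₗ (Del r) ∘ₗ LinearMap.proj j
  have hΨ : ∀ q, Ψ q = ∑ j, ∑ i, M i j (dd K i (Del r (q j))) := by
    intro q; simp [Ψ]
  have key : ∀ a b p, Ψ (fun j => p * ee K a b j) = M a b p := by
    intro a b p
    induction p using MvPolynomial.induction_on' with
    | add p q hp hq =>
      rw [map_add, ← hp, ← hq, ← map_add]; congr 1; ext1 j; simp [add_mul]
    | monomial m c =>
      rw [hΨ]
      have e1 : ∀ j, (monomial m c : PP K ι) * ee K a b j =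
          (if b = j then monomial m c * XX K a else 0) - (if a = j then monomial m c * XX K b else 0) := by
        intro j
        simp only [ee, dl]; split_ifs <;> simp <;> ring
      simp only [e1, map_sub, apply_ite (Del r), map_zero, apply_ite (dd K _), apply_ite (M _ _),
        Finset.sum_sub_distrib, Finset.sum_ite_irrel, Finset.sum_ite_eq,
        Finset.mem_univ, if_true, Finset.sum_const_zero, Del_mul, Derivation.map_smul, map_smul]
      rw [← Finset.smul_sum, ← Finset.smul_sum, ← smul_sub, lem1 M anti J (Eul_mono m c), smul_smul]
      have : ((wt m + 1 : ℕ) : K) + 1 ≠ 0 := by exact_mod_cast Nat.succ_ne_zero (wt m + 1)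
      have e3 : r (wt m + 1) * (2 + (wt m : K)) = 1 := by
        simp only [r]
        push_cast at this ⊢
        field_simp
        ring
      rw [e3, one_smul]
  calc ∑ a, ∑ b, M a b (z a b) = Ψ (∑ a, ∑ b, fun j => z a b * ee K a b j) := by
        simp only [map_sum, key]
    _ = 0 := by
        rw [← map_zero Ψ]; congr 1; ext1 j; simp [hz]

theorem inj2 [CharZero K] (M : ι → ι → ι → ι → PP K ι →ₗ[K] W)
    (anti1 : ∀ a b c d p, M a b c d p = - M b a c d p)
    (anti2 : ∀ a b c d p, M a b c d p = - M a b d c p)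
    (J1 : ∀ k a b c d p, M a b c d (XX K k * p) = M k b c d (XX K a * p) - M k a c d (XX K b * p))
    (J2 : ∀ k a b c d p, M a b c d (XX K k * p) = M a b k d (XX K c * p) - M a b k c (XX K d * p))
    (S : ∀ a b c d p, M a b c d p + M c d a b p - M a c b d p - M b d a c p
       + M a d b c p + M b c a d p = 0)
    (z : ι → ι → ι → ι → PP K ι)
    (hz : ∀ j l, ∑ a, ∑ b, ∑ c, ∑ d, z a b c d * (ee K a b j * ee K c d l) = 0) :
    ∑ a, ∑ b, ∑ c, ∑ d, M a b c d (z a b c d) = 0 := by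
  let N : ℕ → K := fun e => (e : K) ^ 2 + 5 * e + 5
  let Ψ : (ℕ → K) → (ι → ι → PP K ι) →ₗ[K] W := fun r =>
    ∑ j, ∑ l, ∑ i, ∑ k, (M i j k l) ∘ₗ (dd K i).toLinearMap ∘ₗ (dd K k).toLinearMap ∘ₗ (Del r)
      ∘ₗ LinearMap.proj l ∘ₗ LinearMap.proj j
  have hΨ : ∀ r q, Ψ r q = ∑ j, ∑ l, ∑ i, ∑ k, M i j k l (dd K i (dd K k (Del r (q j l)))) := by
    intro r q; simp [Ψ]
  have key : ∀ r a b c d m s, Ψ r (fun j l => monomial m s * (ee K a b j * ee K c d l)) =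
      r (wt m + 2) • (N (wt m) • M a b c d (monomial m s) + M c d a b (monomial m s)) := by
    intro r a b c d m s
    rw [hΨ]
    have e1 : ∀ j l, (monomial m s : PP K ι) * (ee K a b j * ee K c d l) =
        (if b = j then if d = l then monomial m s * (XX K a * XX K c) else 0 else 0)
        - (if a = j then if d = l then monomial m s * (XX K b * XX K c) else 0 else 0)
        - (if b = j then if c = l then monomial m s * (XX K a * XX K d) else 0 else 0)
        + (if a = j then if c = l then monomial m s * (XX K b * XX K d) else 0 else 0) := by
      intro j l
      simp only [ee, dl]; split_ifs <;> simp <;> ring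
    simp only [e1, map_sub, map_add, apply_ite (Del r), map_zero, apply_ite (dd K _),
      apply_ite (M _ _ _ _), Finset.sum_add_distrib,
      Finset.sum_sub_distrib, Finset.sum_ite_irrel, Finset.sum_ite_eq,
      Finset.mem_univ, if_true, Finset.sum_const_zero, Del_mul2, Derivation.map_smul, map_smul]
    simp only [← Finset.smul_sum]
    rw [← lem2 M anti1 anti2 J1 J2 S (Eul_mono m s)]
    module
  have hN : ∀ e, N e ^ 2 - 1 ≠ 0 := by
    intro e
    have : N e ^ 2 - 1 = (((e ^ 2 + 5 * e + 5) ^ 2 - 1 : ℤ) : K) := by simp [N]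
    rw [this, Int.cast_ne_zero]
    nlinarith [sq_nonneg (e : ℤ), Int.natCast_nonneg e]
  let r1 : ℕ → K := fun d => N (d - 2) / (N (d - 2) ^ 2 - 1)
  let r2 : ℕ → K := fun d => 1 / (N (d - 2) ^ 2 - 1)
  have key2 : ∀ a b c d p, Ψ r1 (fun j l => p * (ee K a b j * ee K c d l))
      - Ψ r2 (fun j l => p * (ee K c d j * ee K a b l)) = M a b c d p := by
    intro a b c d p
    induction p using MvPolynomial.induction_on' with
    | add p q hp hq =>
      rw [map_add, ← hp, ← hq]
      have : ∀ r a b c d, Ψ r (fun j l => (p + q) * (ee K a b j * ee K c d l)) =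
        Ψ r (fun j l => p * (ee K a b j * ee K c d l)) +
        Ψ r (fun j l => q * (ee K a b j * ee K c d l)) := by
        intro r a b c d
        rw [← map_add]; congr 1; ext1 j; ext1 l; simp [add_mul]
      rw [this, this]; abel
    | monomial m s =>
      rw [key, key]
      have h := hN (wt m)
      simp only [r1, r2, Nat.add_sub_cancel]
      match_scalars
      · field_simp
      · field_simp
        ring
  have h1 : ∀ r, ∑ a, ∑ b, ∑ c, ∑ d, Ψ r (fun j l => z a b c d * (ee K a b j * ee K c d l)) = 0 := by
    intro r
    simp only [← map_sum]
    rw [← map_zero (Ψ r)]; congr 1; ext1 j; ext1 l; simp [hz]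
  have h2 : ∀ r, ∑ a, ∑ b, ∑ c, ∑ d, Ψ r (fun j l => z a b c d * (ee K c d j * ee K a b l)) = 0 := by
    intro r
    simp only [← map_sum]
    rw [← map_zero (Ψ r)]; congr 1; ext1 j; ext1 l
    have := hz l j
    simp only [mul_comm (ee K _ _ l)] at this
    simp [this]
  have h3 := congrArg₂ (fun x y => x - y) (h1 r1) (h2 r2)
  simp only [← Finset.sum_sub_distrib, key2, sub_zero] at h3
  exact h3

end KZ

end SecKoz

noncomputable section SecB
set_option linter.unusedSectionVars false
open MvPolynomial KZ

namespace KZ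

lemma ker_ab {K : Type*} [Field K] {σ : Type*} (J : TwoSidedIdeal (FreeAlgebra K σ))
    (hJ : ∀ i j, FreeAlgebra.ι K i * FreeAlgebra.ι K j - FreeAlgebra.ι K j * FreeAlgebra.ι K i ∈ J)
    (u : FreeAlgebra K σ) (hu : FreeAlgebra.lift K (X : σ → MvPolynomial σ K) u = 0) : u ∈ J := by
  let Q := J.ringCon.Quotient
  let mk : FreeAlgebra K σ →ₐ[K] Q := J.ringCon.mkₐ K
  have hmk : ∀ x, mk x = 0 ↔ x ∈ J := by
    intro x
    rw [← map_zero mk]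
    exact RingCon.eq _
  have hs : Function.Surjective mk := RingCon.mkₐ_surjective _
  have hc1 : ∀ i (b : FreeAlgebra K σ), mk (FreeAlgebra.ι K i) * mk b = mk b * mk (FreeAlgebra.ι K i) := by
    intro i b
    induction b using FreeAlgebra.induction with
    | grade0 r => rw [AlgHom.commutes]; exact (Algebra.commutes _ _).symm
    | grade1 j =>
      rw [← sub_eq_zero, ← map_mul, ← map_mul, ← map_sub, hmk]; exact hJ i j
    | mul a b ha hb => rw [map_mul, ← mul_assoc, ha, mul_assoc, hb, mul_assoc]
    | add a b ha hb => rw [map_add, mul_add, ha, hb, add_mul]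
  have hc : ∀ a b : FreeAlgebra K σ, mk a * mk b = mk b * mk a := by
    intro a b
    induction a using FreeAlgebra.induction with
    | grade0 r => rw [AlgHom.commutes]; exact (Algebra.commutes _ _)
    | grade1 j => exact hc1 j b
    | mul a c ha hb => rw [map_mul, ← mul_assoc, ← ha, mul_assoc, hb, mul_assoc]
    | add a c ha hb => rw [map_add, add_mul, ha, hb, mul_add]
  letI : CommRing Q := { (inferInstance : Ring Q) with
    mul_comm := by
      intro a b
      obtain ⟨a, rfl⟩ := hs a
      obtain ⟨b, rfl⟩ := hs b
      exact hc a b }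
  let g : MvPolynomial σ K →ₐ[K] Q := aeval (fun i => mk (FreeAlgebra.ι K i))
  have hg : g.comp (FreeAlgebra.lift K (X : σ → MvPolynomial σ K)) = mk := by
    apply FreeAlgebra.hom_ext
    ext i
    simp [g]
  rw [← hmk, ← hg, AlgHom.comp_apply, hu, map_zero]

section core
variable {K : Type*} [Field K] {ι : Type*} [Fintype ι] [DecidableEq ι]
variable {A : Type*} [Ring A] [Algebra K A]

def CC (K : Type*) [Field K] {ι : Type*} {A : Type*} [Ring A] [Algebra K A] (t : ι → A) :
    Submodule K A :=
  Submodule.span K {x | ∃ a i j b, x = a * br (t i) (t j) * b}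

variable {t : ι → A}

lemma CC_left {v : A} (hv : v ∈ CC K t) (a : A) : a * v ∈ CC K t := by
  induction hv using Submodule.span_induction with
  | mem x hx =>
    obtain ⟨c, i, j, b, rfl⟩ := hx
    exact Submodule.subset_span ⟨a * c, i, j, b, by simp only [mul_assoc]⟩
  | zero => simp
  | add x y _ _ hx hy => rw [mul_add]; exact add_mem hx hy
  | smul r x _ hx => rw [mul_smul_comm]; exact Submodule.smul_mem _ _ hx

lemma CC_right {v : A} (hv : v ∈ CC K t) (a : A) : v * a ∈ CC K t := by
  induction hv using Submodule.span_induction with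
  | mem x hx =>
    obtain ⟨c, i, j, b, rfl⟩ := hx
    exact Submodule.subset_span ⟨c, i, j, b * a, by simp only [mul_assoc]⟩
  | zero => simp
  | add x y _ _ hx hy => rw [add_mul]; exact add_mem hx hy
  | smul r x _ hx => rw [smul_mul_assoc]; exact Submodule.smul_mem _ _ hx

lemma br_gen (i j : ι) : br (t i) (t j) ∈ CC K t :=
  Submodule.subset_span ⟨1, i, j, 1, by simp⟩

lemma br_mul {A : Type*} [Ring A] (x a b : A) : br x (a * b) = br x a * b + a * br x b := by
  unfold br; noncomm_ring
lemma br_mul' {A : Type*} [Ring A] (x a b : A) : br (a * b) x = br a x * b + a * br b x := by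
  unfold br; noncomm_ring

variable (hs : Function.Surjective (FreeAlgebra.lift K t))
include hs

lemma br_mem (a b : A) : br a b ∈ CC K t := by
  obtain ⟨a, rfl⟩ := hs a
  obtain ⟨b, rfl⟩ := hs b
  have h1 : ∀ i b, br (t i) (FreeAlgebra.lift K t b) ∈ CC K t := by
    intro i b
    induction b using FreeAlgebra.induction with
    | grade0 r =>
      rw [AlgHom.commutes, br, Algebra.commutes, sub_self]; exact zero_mem _
    | grade1 j => rw [FreeAlgebra.lift_ι_apply]; exact br_gen i j
    | mul a b ha hb =>
      rw [map_mul, br_mul]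
      exact add_mem (CC_right ha _) (CC_left hb _)
    | add a b ha hb =>
      have := add_mem ha hb
      simp only [br, map_add] at *
      convert this using 1; noncomm_ring
  induction a using FreeAlgebra.induction with
  | grade0 r =>
    rw [AlgHom.commutes, br, Algebra.commutes, sub_self]; exact zero_mem _
  | grade1 j => rw [FreeAlgebra.lift_ι_apply]; exact h1 j b
  | mul a b ha hb =>
    rw [map_mul, br_mul']
    exact add_mem (CC_right ha _) (CC_left hb _)
  | add a b ha hb =>
    have := add_mem ha hb
    simp only [br, map_add] at *
    convert this using 1; noncomm_ring
omit hs

variable (h1 : ∀ a b c d e : A, br (br a b * br c d) e = 0)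
  (h2 : ∀ a b c d e f : A, br a b * br c d * br e f = 0)
include h1 h2

lemma triple0 (a b c d e f y : A) : br a b * br c d * y * br e f = 0 := by
  have := h1 a b c d y
  rw [br, sub_eq_zero] at this
  rw [this, mul_assoc, h2, mul_zero]

lemma triple (a b c d e f x y : A) : br a b * x * br c d * y * br e f = 0 := by
  have e1 : br a b * x = x * br a b + br (br a b) x := by unfold br; noncomm_ring
  rw [e1]
  have e2 := triple0 h1 h2 a b c d e f y
  have e3 := triple0 h1 h2 (br a b) x c d e f y
  simp only [add_mul, mul_assoc] at *
  rw [e2, e3]; simp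

lemma triple' (a b c d e f x y : A) : br a b * (x * (br c d * (y * br e f))) = 0 := by
  have := triple h1 h2 a b c d e f x y
  simpa only [mul_assoc] using this

lemma cent (a b c d x e : A) : br a b * x * br c d * e = e * (br a b * x * br c d) := by
  have e1 : br a b * x = x * br a b + br (br a b) x := by unfold br; noncomm_ring
  rw [e1]
  have f1 := h1 a b c d e
  have f2 := h1 (br a b) x c d e
  have f3 := triple' h1 h2 x e a b c d 1 1
  rw [← sub_eq_zero]
  have : (x * br a b + br (br a b) x) * br c d * e - e * ((x * br a b + br (br a b) x) * br c d) =
    br x e * (1 * (br a b * (1 * br c d))) + x * br (br a b * br c d) e + br (br (br a b) x * br c d) e := by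
    generalize br a b = p
    generalize br c d = q
    generalize hr : br p x = r
    unfold br; noncomm_ring
  rw [this, f1, f2, f3]; simp

lemma CC_cent {v w : A} (hv : v ∈ CC K t) (hw : w ∈ CC K t) (e : A) : v * w * e = e * (v * w) := by
  induction hv using Submodule.span_induction with
  | zero => simp
  | add x y _ _ hx hy => simp only [add_mul, mul_add, hx, hy]
  | smul r x _ hx => simp only [smul_mul_assoc, mul_smul_comm, hx]
  | mem x hx =>
  induction hw using Submodule.span_induction with
  | zero => simp
  | add x y _ _ hx hy => simp only [add_mul, mul_add, hx, hy]
  | smul r x _ hx => simp only [smul_mul_assoc, mul_smul_comm, hx]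
  | mem y hy =>
    obtain ⟨a, i, j, b, rfl⟩ := hx
    obtain ⟨c, k, l, d, rfl⟩ := hy
    set u := br (t i) (t j) * (b * c) * br (t k) (t l) with hu
    have e1 : a * br (t i) (t j) * b * (c * br (t k) (t l) * d) = a * u * d := by
      simp only [hu, mul_assoc]
    have e2 : ∀ e, u * e = e * u := fun e => cent h1 h2 _ _ _ _ _ _
    have e3 : br (a * d) e * u = 0 := by
      have := triple' h1 h2 (a * d) e (t i) (t j) (t k) (t l) 1 (b * c)
      simpa only [hu, mul_assoc, one_mul] using this
    rw [e1]
    clear_value u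
    rw [mul_assoc a, e2 d, ← mul_assoc a, mul_assoc, e2 e, ← mul_assoc, ← mul_assoc,
      ← sub_eq_zero, ← sub_mul]
    exact e3

lemma CC_triple {v w x : A} (hv : v ∈ CC K t) (hw : w ∈ CC K t) (hx : x ∈ CC K t) : v * w * x = 0 := by
  induction hv using Submodule.span_induction with
  | zero => simp
  | add x y _ _ hx hy => simp only [add_mul, hx, hy, add_zero]
  | smul r x _ hx => simp only [smul_mul_assoc, hx, smul_zero]
  | mem v hv =>
  induction hw using Submodule.span_induction with
  | zero => simp
  | add x y _ _ hx hy => simp only [add_mul, mul_add, hx, hy, add_zero]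
  | smul r x _ hx => simp only [smul_mul_assoc, mul_smul_comm, hx, smul_zero]
  | mem w hw =>
  induction hx using Submodule.span_induction with
  | zero => simp
  | add x y _ _ hx hy => simp only [mul_add, hx, hy, add_zero]
  | smul r x _ hx => simp only [mul_smul_comm, hx, smul_zero]
  | mem y hy =>
    obtain ⟨a, i, j, b, rfl⟩ := hv
    obtain ⟨c, k, l, d, rfl⟩ := hw
    obtain ⟨e, m, n, f, rfl⟩ := hy
    have := triple' h1 h2 (t i) (t j) (t k) (t l) (t m) (t n) (b * c) (d * e)
    simp only [mul_assoc] at this ⊢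
    have h3 := congrArg (fun z => a * (z * f)) this
    simpa only [mul_assoc, zero_mul, mul_zero] using h3

lemma CC_triple2 {v x : A} (hv : v ∈ CC K t * CC K t) (hx : x ∈ CC K t) : v * x = 0 := by
  induction hv using Submodule.mul_induction_on' with
  | mem_mul_mem m hm n hn => exact CC_triple h1 h2 hm hn hx
  | add x _ y _ hx hy => rw [add_mul, hx, hy, add_zero]
omit h1 h2

lemma C2_left {v : A} (hv : v ∈ CC K t * CC K t) (a : A) : a * v ∈ CC K t * CC K t := by
  induction hv using Submodule.mul_induction_on' with
  | mem_mul_mem m hm n hn => rw [← mul_assoc]; exact Submodule.mul_mem_mul (CC_left hm a) hn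
  | add x _ y _ hx hy => rw [mul_add]; exact add_mem hx hy

lemma C2_right {v : A} (hv : v ∈ CC K t * CC K t) (a : A) : v * a ∈ CC K t * CC K t := by
  induction hv using Submodule.mul_induction_on' with
  | mem_mul_mem m hm n hn => rw [mul_assoc]; exact Submodule.mul_mem_mul hm (CC_right hn a)
  | add x _ y _ hx hy => rw [add_mul]; exact add_mem hx hy

variable (t) in
def op : FreeAlgebra K (ι ⊕ ι) →ₐ[K] Module.End K A :=
  FreeAlgebra.lift K (Sum.elim (fun i => LinearMap.mulLeft K (t i))
    (fun i => LinearMap.mulLeft K (t i) - LinearMap.mulRight K (t i)))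

lemma op_l (i : ι) (v : A) : op (K := K) t (FreeAlgebra.ι K (Sum.inl i)) v = t i * v := by simp [op]
lemma op_r (i : ι) (v : A) : op (K := K) t (FreeAlgebra.ι K (Sum.inr i)) v = t i * v - v * t i := by
  simp [op]

lemma op_stab (S : Submodule K A) (hl : ∀ v ∈ S, ∀ a, a * v ∈ S) (hr : ∀ v ∈ S, ∀ a, v * a ∈ S)
    (u : FreeAlgebra K (ι ⊕ ι)) : ∀ v ∈ S, op t u v ∈ S := by
  induction u using FreeAlgebra.induction with
  | grade0 r => intro v hv; rw [AlgHom.commutes]; simpa using S.smul_mem r hv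
  | grade1 i =>
    intro v hv
    rcases i with i | i
    · rw [op_l]; exact hl v hv _
    · rw [op_r]; exact sub_mem (hl v hv _) (hr v hv _)
  | mul a b ha hb => intro v hv; rw [map_mul]; exact ha _ (hb _ hv)
  | add a b ha hb => intro v hv; rw [map_add]; exact add_mem (ha _ hv) (hb _ hv)

lemma op_C (u : FreeAlgebra K (ι ⊕ ι)) {v : A} (hv : v ∈ CC K t) : op t u v ∈ CC K t :=
  op_stab _ (fun _ h => CC_left h) (fun _ h => CC_right h) u v hv
lemma op_C2 (u : FreeAlgebra K (ι ⊕ ι)) {v : A} (hv : v ∈ CC K t * CC K t) :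
    op t u v ∈ CC K t * CC K t :=
  op_stab _ (fun _ h => C2_left h) (fun _ h => C2_right h) u v hv

lemma op_ker (u : FreeAlgebra K (ι ⊕ ι)) (hu : FreeAlgebra.lift K (X : _ → PP K ι) u = 0)
    {v : A} (hv : v ∈ CC K t) : op t u v ∈ CC K t * CC K t := by
  let J : TwoSidedIdeal (FreeAlgebra K (ι ⊕ ι)) := TwoSidedIdeal.mk'
    {u | ∀ v ∈ CC K t, op t u v ∈ CC K t * CC K t}
    (by intro v _; simp)
    (by intro x y hx hy v hv; rw [map_add]; exact add_mem (hx v hv) (hy v hv))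
    (by intro x hx v hv; rw [map_neg]; exact neg_mem (hx v hv))
    (by intro x y hy v hv; rw [map_mul]; exact op_C2 _ (hy v hv))
    (by intro x y hy v hv; rw [map_mul]; exact hy _ (op_C _ hv))
  have : u ∈ J := by
    refine ker_ab J ?_ u hu
    intro i j
    rw [TwoSidedIdeal.mem_mk']
    intro v hv
    rw [map_sub, map_mul, map_mul, LinearMap.sub_apply, Module.End.mul_apply, Module.End.mul_apply]
    rcases i with i | i <;> rcases j with j | j <;> simp only [op_l, op_r]
    · have := Submodule.mul_mem_mul (br_gen (K := K) (t := t) i j) hv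
      convert this using 1; unfold br; noncomm_ring
    · have := Submodule.mul_mem_mul (br_gen (K := K) (t := t) i j) hv
      convert this using 1; unfold br; noncomm_ring
    · have := Submodule.mul_mem_mul (br_gen (K := K) (t := t) i j) hv
      convert this using 1; unfold br; noncomm_ring
    · have := sub_mem (Submodule.mul_mem_mul (br_gen (K := K) (t := t) i j) hv)
        (Submodule.mul_mem_mul hv (br_gen (K := K) (t := t) i j))
      convert this using 1; unfold br; noncomm_ring
  rw [TwoSidedIdeal.mem_mk'] at this
  exact this v hv

end core
end KZ

end SecB

noncomputable section SecC
set_option linter.unusedSectionVars false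
open MvPolynomial KZ

namespace KZ

lemma Sx {ι W : Type*} [AddCommGroup W] (f : ι → ι → ι → ι → ι → W)
    (J1 : ∀ k a b c d, f k a b c d = f a k b c d - f b k a c d)
    (J2 : ∀ k a b c d, f k a b c d = f c a b k d - f d a b k c) (k a b c d : ι) :
    f k a b c d + f k c d a b - f k a c b d - f k b d a c + f k a d b c + f k b c a d = 0 := by
  linear_combination (norm := module) - J2 b k a c d + J2 a k b c d - J2 a k c b d + J2 a k d b c + J1 k c d a b - J1 k b d a c + J1 k b c a d + J1 k a d b c - J1 k a c b d + J1 k a b c d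

section core
variable {K : Type*} [Field K] {ι : Type*} [Fintype ι] [DecidableEq ι]
variable {A : Type*} [Ring A] [Algebra K A]

lemma abSurj {σ : Type*} : Function.Surjective (FreeAlgebra.lift K (X : σ → MvPolynomial σ K)) := by
  intro p
  induction p using MvPolynomial.induction_on with
  | C a => exact ⟨algebraMap _ _ a, by rw [AlgHom.commutes]; rfl⟩
  | add p q hp hq =>
    obtain ⟨p, rfl⟩ := hp
    obtain ⟨q, rfl⟩ := hq
    exact ⟨p + q, map_add _ _ _⟩
  | mul_X p i hp =>
    obtain ⟨p, rfl⟩ := hp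
    exact ⟨p * FreeAlgebra.ι K i, by simp⟩

lemma sec_ex : ∃ s : PP K ι →ₗ[K] FreeAlgebra K (ι ⊕ ι),
    ∀ p, FreeAlgebra.lift K (X : _ → PP K ι) (s p) = p := by
  obtain ⟨s, hs⟩ := LinearMap.exists_rightInverse_of_surjective
    (FreeAlgebra.lift K (X : _ → PP K ι)).toLinearMap (LinearMap.range_eq_top.2 abSurj)
  exact ⟨s, fun p => by simpa using LinearMap.congr_fun hs p⟩

def sec : PP K ι →ₗ[K] FreeAlgebra K (ι ⊕ ι) := sec_ex.choose
lemma sec_spec (p : PP K ι) : FreeAlgebra.lift K (X : _ → PP K ι) (sec p) = p := sec_ex.choose_spec p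

variable (t : ι → A)
def rho : PP K ι →ₗ[K] Module.End K A := (op t).toLinearMap ∘ₗ sec

variable {t}
lemma rho_op (p : PP K ι) (v : A) : rho t p v = op t (sec p) v := rfl

lemma rho_C (p : PP K ι) {v : A} (hv : v ∈ CC K t) : rho t p v ∈ CC K t := op_C _ hv

lemma rho_congr (u : FreeAlgebra K (ι ⊕ ι)) (p : PP K ι)
    (hp : FreeAlgebra.lift K (X : _ → PP K ι) u = p)
    {v : A} (hv : v ∈ CC K t) : rho t p v - op t u v ∈ CC K t * CC K t := by
  have := op_ker (t := t) (sec p - u) (by rw [map_sub, sec_spec, hp, sub_self]) hv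
  simpa [rho_op] using this

lemma rho_x (i : ι) (p : PP K ι) {v : A} (hv : v ∈ CC K t) :
    rho t (xx K i * p) v - t i * rho t p v ∈ CC K t * CC K t := by
  have := rho_congr (t := t) (FreeAlgebra.ι K (Sum.inl i) * sec p) (xx K i * p)
    (by rw [map_mul, sec_spec, FreeAlgebra.lift_ι_apply]; rfl) hv
  rwa [map_mul (op t), Module.End.mul_apply, op_l] at this

lemma rho_X (i : ι) (p : PP K ι) {v : A} (hv : v ∈ CC K t) :
    rho t (XX K i * p) v - (t i * rho t p v - rho t p v * t i) ∈ CC K t * CC K t := by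
  have := rho_congr (t := t) (FreeAlgebra.ι K (Sum.inr i) * sec p) (XX K i * p)
    (by rw [map_mul, sec_spec, FreeAlgebra.lift_ι_apply]; rfl) hv
  rwa [map_mul (op t), Module.End.mul_apply, op_r] at this

lemma rho_X' (i : ι) (p : PP K ι) {v : A} (hv : v ∈ CC K t) :
    rho t (XX K i * p) v - rho t p (t i * v - v * t i) ∈ CC K t * CC K t := by
  have := rho_congr (t := t) (sec p * FreeAlgebra.ι K (Sum.inr i)) (XX K i * p)
    (by rw [map_mul, sec_spec, FreeAlgebra.lift_ι_apply, mul_comm]; rfl) hv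
  rwa [map_mul (op t), Module.End.mul_apply, op_r] at this

lemma rho_K (a : K) {v : A} (hv : v ∈ CC K t) :
    rho t (C a) v - a • v ∈ CC K t * CC K t := by
  have := rho_congr (t := t) (algebraMap _ _ a) (C a) (by rw [AlgHom.commutes]; rfl) hv
  rwa [AlgHom.commutes, Module.algebraMap_end_apply] at this

variable (K t) in
def M1 (a b : ι) : PP K ι →ₗ[K] A ⧸ (CC K t * CC K t) :=
  (CC K t * CC K t).mkQ ∘ₗ LinearMap.applyₗ (br (t a) (t b)) ∘ₗ rho t

lemma M1_apply (a b : ι) (p : PP K ι) :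
    M1 K t a b p = (CC K t * CC K t).mkQ (rho t p (br (t a) (t b))) := rfl

lemma br_anti {A : Type*} [Ring A] (a b : A) : br a b = - br b a := by unfold br; simp

lemma jac {A : Type*} [Ring A] (k a b : A) : k * br a b - br a b * k =
    (a * br k b - br k b * a) - (b * br k a - br k a * b) := by unfold br; noncomm_ring

lemma M1_anti (a b : ι) (p : PP K ι) : M1 K t a b p = - M1 K t b a p := by
  rw [M1_apply, M1_apply, br_anti (t a), map_neg, map_neg]

lemma M1_X (k a b : ι) (p : PP K ι) : M1 K t a b (XX K k * p) =
    (CC K t * CC K t).mkQ (rho t p (t k * br (t a) (t b) - br (t a) (t b) * t k)) := by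
  rw [M1_apply, ← sub_eq_zero, ← map_sub, Submodule.mkQ_apply, Submodule.Quotient.mk_eq_zero]
  exact rho_X' _ _ (br_gen _ _)

lemma M1_J (k a b : ι) (p : PP K ι) :
    M1 K t a b (XX K k * p) = M1 K t k b (XX K a * p) - M1 K t k a (XX K b * p) := by
  rw [M1_X, M1_X, M1_X, ← map_sub, ← map_sub, jac]

variable (K t) in
def M2 (a b c d : ι) : PP K ι →ₗ[K] A :=
  LinearMap.mulRight K (br (t c) (t d)) ∘ₗ LinearMap.applyₗ (br (t a) (t b)) ∘ₗ rho t

lemma M2_apply (a b c d : ι) (p : PP K ι) :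
    M2 K t a b c d p = rho t p (br (t a) (t b)) * br (t c) (t d) := rfl

lemma span_exists {κ V W : Type*} [Fintype κ] [DecidableEq κ] [AddCommGroup V] [AddCommGroup W]
    [Module K V] [Module K W] (M : κ → V →ₗ[K] W) (w : W)
    (hw : w ∈ Submodule.span K {x | ∃ k p, x = M k p}) : ∃ z : κ → V, w = ∑ k, M k (z k) := by
  induction hw using Submodule.span_induction with
  | mem x hx =>
    obtain ⟨k, p, rfl⟩ := hx
    refine ⟨fun k' => if k' = k then p else 0, ?_⟩
    rw [Finset.sum_eq_single k]
    · simp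
    · intro b _ hb; simp [hb]
    · simp
  | zero => exact ⟨0, by simp⟩
  | add x y _ _ hx hy =>
    obtain ⟨z, rfl⟩ := hx
    obtain ⟨z', rfl⟩ := hy
    exact ⟨z + z', by simp [Finset.sum_add_distrib]⟩
  | smul r x _ hx =>
    obtain ⟨z, rfl⟩ := hx
    exact ⟨r • z, by simp [Finset.smul_sum]⟩

variable (K t) in
def N1 : Submodule K A :=
  Submodule.span K ({x | ∃ a b, ∃ p : PP K ι, x = rho t p (br (t a) (t b))} ∪ (CC K t * CC K t : Submodule K A))

lemma N1_2 {v : A} (h : v ∈ CC K t * CC K t) : v ∈ N1 K t := Submodule.subset_span (Or.inr h)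
lemma N1_1 (a b : ι) (p : PP K ι) : rho t p (br (t a) (t b)) ∈ N1 K t :=
  Submodule.subset_span (Or.inl ⟨a, b, p, rfl⟩)

lemma N1_l (k : ι) {v : A} (h : v ∈ N1 K t) : t k * v ∈ N1 K t := by
  induction h using Submodule.span_induction with
  | mem x hx =>
    rcases hx with ⟨a, b, p, rfl⟩ | hx
    · have := sub_mem (N1_1 a b (xx K k * p)) (N1_2 (rho_x (t := t) k p (br_gen a b)))
      simpa using this
    · exact N1_2 (C2_left hx _)
  | zero => simp
  | add x y _ _ hx hy => rw [mul_add]; exact add_mem hx hy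
  | smul r x _ hx => rw [mul_smul_comm]; exact Submodule.smul_mem _ _ hx

lemma N1_r (k : ι) {v : A} (h : v ∈ N1 K t) : v * t k ∈ N1 K t := by
  induction h using Submodule.span_induction with
  | mem x hx =>
    rcases hx with ⟨a, b, p, rfl⟩ | hx
    · have := sub_mem (N1_l k (N1_1 a b p))
        (sub_mem (N1_1 a b (XX K k * p)) (N1_2 (rho_X (t := t) k p (br_gen a b))))
      simpa using this
    · exact N1_2 (C2_right hx _)
  | zero => simp
  | add x y _ _ hx hy => rw [add_mul]; exact add_mem hx hy
  | smul r x _ hx => rw [smul_mul_assoc]; exact Submodule.smul_mem _ _ hx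

lemma stab_l {N : Submodule K A} (hN : ∀ k, ∀ v ∈ N, t k * v ∈ N) (a : FreeAlgebra K ι) :
    ∀ v ∈ N, FreeAlgebra.lift K t a * v ∈ N := by
  induction a using FreeAlgebra.induction with
  | grade0 r => intro v hv; rw [AlgHom.commutes, ← Algebra.smul_def]; exact N.smul_mem _ hv
  | grade1 i => intro v hv; rw [FreeAlgebra.lift_ι_apply]; exact hN i v hv
  | mul a b ha hb => intro v hv; rw [map_mul, mul_assoc]; exact ha _ (hb _ hv)
  | add a b ha hb => intro v hv; rw [map_add, add_mul]; exact add_mem (ha _ hv) (hb _ hv)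

lemma stab_r {N : Submodule K A} (hN : ∀ k, ∀ v ∈ N, v * t k ∈ N) (a : FreeAlgebra K ι) :
    ∀ v ∈ N, v * FreeAlgebra.lift K t a ∈ N := by
  induction a using FreeAlgebra.induction with
  | grade0 r => intro v hv; rw [AlgHom.commutes, ← Algebra.commutes, ← Algebra.smul_def]; exact N.smul_mem _ hv
  | grade1 i => intro v hv; rw [FreeAlgebra.lift_ι_apply]; exact hN i v hv
  | mul a b ha hb => intro v hv; rw [map_mul, ← mul_assoc]; exact hb _ (ha _ hv)
  | add a b ha hb => intro v hv; rw [map_add, mul_add]; exact add_mem (ha _ hv) (hb _ hv)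

lemma N1_gen (i j : ι) : br (t i) (t j) ∈ N1 K t := by
  have := sub_mem (N1_1 i j (C 1)) (N1_2 (rho_K (t := t) (1 : K) (br_gen i j)))
  simpa using this

lemma N1_mk {v : A} (h : v ∈ N1 K t) :
    (CC K t * CC K t).mkQ v ∈ Submodule.span K {x | ∃ k : ι × ι, ∃ p, x = M1 K t k.1 k.2 p} := by
  induction h using Submodule.span_induction with
  | mem x hx =>
    rcases hx with ⟨a, b, p, rfl⟩ | hx
    · exact Submodule.subset_span ⟨(a, b), p, rfl⟩
    · rw [Submodule.mkQ_apply, (Submodule.Quotient.mk_eq_zero _).2 hx]; exact zero_mem _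
  | zero => simp
  | add x y _ _ hx hy => rw [map_add]; exact add_mem hx hy
  | smul r x _ hx => rw [map_smul]; exact Submodule.smul_mem _ _ hx

variable (hs : Function.Surjective (FreeAlgebra.lift K t))
include hs

lemma CC_N1 : CC K t ≤ N1 K t := by
  rw [CC, Submodule.span_le]
  rintro _ ⟨a, i, j, b, rfl⟩
  obtain ⟨a, rfl⟩ := hs a
  obtain ⟨b, rfl⟩ := hs b
  exact stab_r (fun k v hv => N1_r k hv) b _ (stab_l (fun k v hv => N1_l k hv) a _ (N1_gen i j))

lemma CC_form {v : A} (hv : v ∈ CC K t) : ∃ z : ι → ι → PP K ι,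
    (CC K t * CC K t).mkQ v = ∑ a, ∑ b, M1 K t a b (z a b) := by
  obtain ⟨z, hz⟩ := span_exists _ _ (N1_mk (CC_N1 hs hv))
  exact ⟨fun a b => z (a, b), by rw [hz, Fintype.sum_prod_type]⟩

variable (h1 : ∀ a b c d e : A, br (br a b * br c d) e = 0)
  (h2 : ∀ a b c d e f : A, br a b * br c d * br e f = 0)
include h1 h2

lemma C2_form {v : A} (hv : v ∈ CC K t * CC K t) : ∃ z : ι → ι → ι → ι → PP K ι,
    v = ∑ a, ∑ b, ∑ c, ∑ d, M2 K t a b c d (z a b c d) := by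
  have key : CC K t * CC K t ≤ Submodule.span K
      {x | ∃ k : ι × ι × ι × ι, ∃ p, x = M2 K t k.1 k.2.1 k.2.2.1 k.2.2.2 p} := by
    have k1 : ∀ c d, ∀ v ∈ N1 K t, v * br (t c) (t d) ∈ Submodule.span K
      {x | ∃ k : ι × ι × ι × ι, ∃ p, x = M2 K t k.1 k.2.1 k.2.2.1 k.2.2.2 p} := by
      intro c d v hv
      induction hv using Submodule.span_induction with
      | mem x hx =>
        rcases hx with ⟨a, b, p, rfl⟩ | hx
        · exact Submodule.subset_span ⟨(a, b, c, d), p, rfl⟩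
        · rw [CC_triple2 h1 h2 hx (br_gen c d)]; exact zero_mem _
      | zero => simp
      | add x y _ _ hx hy => rw [add_mul]; exact add_mem hx hy
      | smul r x _ hx => rw [smul_mul_assoc]; exact Submodule.smul_mem _ _ hx
    rw [Submodule.mul_le]
    intro v hv w hw
    induction hw using Submodule.span_induction with
    | mem x hx =>
      obtain ⟨a, i, j, b, rfl⟩ := hx
      have e := CC_cent h1 h2 (CC_right hv a) (br_gen i j) b
      have e' : v * (a * br (t i) (t j) * b) = b * v * a * br (t i) (t j) := by
        simp only [mul_assoc] at e ⊢; exact e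
      rw [e']
      exact k1 _ _ _ (CC_N1 hs (CC_right (CC_left hv b) a))
    | zero => simp
    | add x y _ _ hx hy => rw [mul_add]; exact add_mem hx hy
    | smul r x _ hx => rw [mul_smul_comm]; exact Submodule.smul_mem _ _ hx
  obtain ⟨z, hz⟩ := span_exists _ _ (key hv)
  refine ⟨fun a b c d => z (a, b, c, d), hz.trans ?_⟩
  simp only [Fintype.sum_prod_type]

omit hs

lemma C2_mul_br {v w : A} (h : v - w ∈ CC K t * CC K t) (c d : ι) :
    v * br (t c) (t d) = w * br (t c) (t d) := by
  rw [← sub_eq_zero, ← sub_mul]; exact CC_triple2 h1 h2 h (br_gen c d)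

lemma M2_x (k a b c d : ι) (p : PP K ι) : M2 K t a b c d (xx K k * p) = t k * M2 K t a b c d p := by
  rw [M2_apply, M2_apply, C2_mul_br h1 h2 (rho_x k p (br_gen a b)), mul_assoc]

lemma M2_K (a b c d : ι) (r : K) : M2 K t a b c d (C r) = r • (br (t a) (t b) * br (t c) (t d)) := by
  rw [M2_apply, C2_mul_br h1 h2 (rho_K r (br_gen a b)), smul_mul_assoc]

lemma M2_X1 (k a b c d : ι) (p : PP K ι) : M2 K t a b c d (XX K k * p) =
    rho t p (t k * br (t a) (t b) - br (t a) (t b) * t k) * br (t c) (t d) := by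
  rw [M2_apply, C2_mul_br h1 h2 (rho_X' k p (br_gen a b))]

lemma M2_J1 (k a b c d : ι) (p : PP K ι) : M2 K t a b c d (XX K k * p) =
    M2 K t k b c d (XX K a * p) - M2 K t k a c d (XX K b * p) := by
  rw [M2_X1 h1 h2, M2_X1 h1 h2, M2_X1 h1 h2, ← sub_mul, ← map_sub, jac]

lemma M2_X2 (k a b c d : ι) (p : PP K ι) : M2 K t a b c d (XX K k * p) =
    - (rho t p (br (t a) (t b)) * (t k * br (t c) (t d) - br (t c) (t d) * t k)) := by
  rw [M2_apply, C2_mul_br h1 h2 (rho_X k p (br_gen a b))]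
  have e := CC_cent h1 h2 (rho_C p (br_gen (K := K) (t := t) a b)) (br_gen (K := K) (t := t) c d) (t k)
  rw [sub_mul, mul_assoc (t k), ← e]
  noncomm_ring

lemma M2_J2 (k a b c d : ι) (p : PP K ι) : M2 K t a b c d (XX K k * p) =
    M2 K t a b k d (XX K c * p) - M2 K t a b k c (XX K d * p) := by
  rw [M2_X2 h1 h2, M2_X2 h1 h2, M2_X2 h1 h2, jac, mul_sub, neg_sub, neg_sub_neg]

lemma M2_S (h3 : ∀ a b c d : A, br a b * br c d + br c d * br a b - br a c * br b d - br b d * br a c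
      + br a d * br b c + br b c * br a d = 0) (p : PP K ι) (a b c d : ι) :
    M2 K t a b c d p + M2 K t c d a b p - M2 K t a c b d p - M2 K t b d a c p + M2 K t a d b c p
      + M2 K t b c a d p = 0 := by
  induction p using MvPolynomial.induction_on with
  | C r =>
    simp only [M2_K h1 h2, ← smul_add, ← smul_sub]
    rw [h3, smul_zero]
  | add p q hp hq =>
    simp only [map_add]
    linear_combination (norm := module) hp + hq
  | mul_X p i hp =>
    rcases i with i | i
    · rw [mul_comm p, show (X (Sum.inl i) : PP K ι) = xx K i from rfl]
      simp only [M2_x h1 h2, ← mul_add, ← mul_sub]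
      rw [hp, mul_zero]
    · rw [mul_comm p, show (X (Sum.inr i) : PP K ι) = XX K i from rfl]
      exact Sx (fun k a b c d => M2 K t a b c d (XX K k * p))
        (fun k a b c d => M2_J1 h1 h2 k a b c d p) (fun k a b c d => M2_J2 h1 h2 k a b c d p) i a b c d

end core
end KZ

end SecC

noncomputable section SecE
set_option linter.unusedSectionVars false
open MvPolynomial KZ

namespace KZ
section core
variable {K : Type*} [Field K] {ι : Type*} [Fintype ι] [DecidableEq ι]
variable {A : Type*} [Ring A] [Algebra K A]
variable {t : ι → A}

/-- evaluation point -/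
def pt (K : Type*) [Field K] {ι : Type*} [DecidableEq ι] (j l i : ι) :
    Matrix (Fin 3) (Fin 3) (PP K ι) :=
  !![xx K i, dl K i j, 0; 0, xx K i - XX K i, dl K i l; 0, 0, xx K i]

variable (hs : Function.Surjective (FreeAlgebra.lift K t))
variable {j l : ι} (E : A →ₐ[K] Matrix (Fin 3) (Fin 3) (PP K ι)) (hE : ∀ i, E (t i) = pt K j l i)
include hs hE

lemma E_upper (a : A) : E a 1 0 = 0 ∧ E a 2 0 = 0 ∧ E a 2 1 = 0 := by
  obtain ⟨a, rfl⟩ := hs a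
  induction a using FreeAlgebra.induction with
  | grade0 r => rw [AlgHom.commutes, AlgHom.commutes]; simp [Matrix.algebraMap_matrix_apply]
  | grade1 i => rw [FreeAlgebra.lift_ι_apply, hE]; simp [pt]
  | mul a b ha hb =>
    rw [map_mul, map_mul]
    simp [Matrix.mul_apply, Fin.sum_univ_three, ha, hb]
  | add a b ha hb =>
    rw [map_add, map_add]; simp [ha, hb]

lemma E_mul00 (a b : A) (i : Fin 3) : E (a * b) i i = E a i i * E b i i := by
  obtain ⟨p, q, r⟩ := E_upper hs E hE a
  obtain ⟨p', q', r'⟩ := E_upper hs E hE b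
  rw [map_mul]
  fin_cases i <;> simp [Matrix.mul_apply, Fin.sum_univ_three, *]

lemma E_diag0 (f : FreeAlgebra K ι) : E (FreeAlgebra.lift K t f) 0 0 =
    rename Sum.inl (FreeAlgebra.lift K (X : ι → MvPolynomial ι K) f) := by
  induction f using FreeAlgebra.induction with
  | grade0 r =>
    rw [AlgHom.commutes, AlgHom.commutes, AlgHom.commutes, AlgHom.commutes]
    simp [Matrix.algebraMap_matrix_apply]
  | grade1 i => rw [FreeAlgebra.lift_ι_apply, FreeAlgebra.lift_ι_apply, hE]; simp [pt, xx]
  | mul a b ha hb => rw [map_mul, E_mul00 hs E hE, ha, hb, map_mul, map_mul]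
  | add a b ha hb => rw [map_add, map_add, Matrix.add_apply, ha, hb, map_add, map_add]

lemma E_CC {v : A} (hv : v ∈ CC K t) (i : Fin 3) : E v i i = 0 := by
  induction hv using Submodule.span_induction with
  | mem x hx =>
    obtain ⟨a, i, j, b, rfl⟩ := hx
    rw [E_mul00 hs E hE, E_mul00 hs E hE, br, map_sub, Matrix.sub_apply, E_mul00 hs E hE,
      E_mul00 hs E hE, mul_comm (E (t i) _ _)]
    simp
  | zero => simp
  | add x y _ _ hx hy => rw [map_add, Matrix.add_apply, hx, hy, add_zero]
  | smul r x _ hx => rw [map_smul, Matrix.smul_apply, hx, smul_zero]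

lemma E_CCmul {v w : A} (hv : v ∈ CC K t) (hw : w ∈ CC K t) :
    E (v * w) 0 1 = 0 ∧ E (v * w) 0 2 = E v 0 1 * E w 1 2 := by
  obtain ⟨p', q', r'⟩ := E_upper hs E hE w
  have a0 := E_CC hs E hE hv 0
  have a1 := E_CC hs E hE hv 1
  have b1 := E_CC hs E hE hw 1
  have b2 := E_CC hs E hE hw 2
  rw [map_mul]
  simp [Matrix.mul_apply, Fin.sum_univ_three, *]

lemma E_C2 {v : A} (hv : v ∈ CC K t * CC K t) : E v 0 1 = 0 := by
  induction hv using Submodule.mul_induction_on' with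
  | mem_mul_mem m hm n hn => exact (E_CCmul hs E hE hm hn).1
  | add x _ y _ hx hy => rw [map_add, Matrix.add_apply, hx, hy, add_zero]

lemma E_op (u : FreeAlgebra K (ι ⊕ ι)) : ∀ v ∈ CC K t, E (op t u v) 0 1 =
    FreeAlgebra.lift K (X : _ → PP K ι) u * E v 0 1 := by
  induction u using FreeAlgebra.induction with
  | grade0 r =>
    intro v hv
    rw [AlgHom.commutes, AlgHom.commutes, Module.algebraMap_end_apply, map_smul, Matrix.smul_apply,
      Algebra.smul_def]
  | grade1 i =>
    intro v hv
    have a0 := E_CC hs E hE hv 0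
    have a1 := E_CC hs E hE hv 1
    obtain ⟨p', q', r'⟩ := E_upper hs E hE v
    rw [FreeAlgebra.lift_ι_apply]
    rcases i with i | i
    · rw [op_l, map_mul, hE]
      simp [Matrix.mul_apply, Fin.sum_univ_three, pt, xx, *]
    · rw [op_r, map_sub, map_mul, map_mul, hE]
      rw [Matrix.sub_apply, Matrix.mul_apply, Matrix.mul_apply, Fin.sum_univ_three, Fin.sum_univ_three,
        a0, a1, r']
      simp [pt, xx, XX]
      ring
  | mul a b ha hb => intro v hv; rw [map_mul, map_mul, Module.End.mul_apply, ha _ (op_C b hv), hb _ hv, mul_assoc]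
  | add a b ha hb =>
    intro v hv
    rw [map_add, map_add, LinearMap.add_apply, map_add, Matrix.add_apply, ha _ hv, hb _ hv, add_mul]

omit hs in
lemma E_br (a b : ι) : E (br (t a) (t b)) 0 1 = ee K a b j ∧ E (br (t a) (t b)) 1 2 = - ee K a b l := by
  rw [br, map_sub, map_mul, map_mul, hE, hE]
  constructor
  · simp [pt, ee]
    ring
  · simp [pt, ee]
    ring

lemma E_rho (p : PP K ι) (a b : ι) : E (rho t p (br (t a) (t b))) 0 1 = p * ee K a b j := by
  rw [rho_op, E_op hs E hE _ _ (br_gen a b), sec_spec, (E_br E hE a b).1]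

lemma E_M2 (p : PP K ι) (a b c d : ι) : E (M2 K t a b c d p) 0 2 =
    - (p * (ee K a b j * ee K c d l)) := by
  rw [M2_apply, (E_CCmul hs E hE (rho_C p (br_gen a b)) (br_gen c d)).2, E_rho hs E hE,
    (E_br E hE c d).2]
  ring

omit hE
theorem core_thm [CharZero K] [Nonempty ι]
    (h1 : ∀ a b c d e : A, br (br a b * br c d) e = 0)
    (h2 : ∀ a b c d e f : A, br a b * br c d * br e f = 0)
    (h3 : ∀ a b c d : A, br a b * br c d + br c d * br a b - br a c * br b d - br b d * br a c
      + br a d * br b c + br b c * br a d = 0)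
    (E : ι → ι → A →ₐ[K] Matrix (Fin 3) (Fin 3) (PP K ι))
    (hE : ∀ j l i, E j l (t i) = pt K j l i) (v : A) (hv : ∀ j l, E j l v = 0) : v = 0 := by
  have i0 : ι := Classical.arbitrary ι
  have s1 : v ∈ CC K t := by
    obtain ⟨f, rfl⟩ := hs v
    have e := E_diag0 hs (E i0 i0) (hE i0 i0) f
    rw [hv, Matrix.zero_apply, eq_comm, ← map_zero (rename Sum.inl)] at e
    have e := rename_injective _ Sum.inl_injective e
    let J : TwoSidedIdeal (FreeAlgebra K ι) := TwoSidedIdeal.mk'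
      {u | FreeAlgebra.lift K t u ∈ CC K t}
      (by simp)
      (by intro x y hx hy; simp only [Set.mem_ofPred_eq, map_add] at *; exact add_mem hx hy)
      (by intro x hx; simp only [Set.mem_ofPred_eq, map_neg] at *; exact neg_mem hx)
      (by intro x y hy; simp only [Set.mem_ofPred_eq, map_mul] at *; exact CC_left hy _)
      (by intro x y hy; simp only [Set.mem_ofPred_eq, map_mul] at *; exact CC_right hy _)
    have : f ∈ J := by
      refine ker_ab J ?_ f e
      intro i j
      rw [TwoSidedIdeal.mem_mk']
      simpa [br] using br_gen (K := K) (t := t) i j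
    rw [TwoSidedIdeal.mem_mk'] at this
    exact this
  have s2 : v ∈ CC K t * CC K t := by
    obtain ⟨z, hz⟩ := CC_form hs s1
    rw [← Submodule.Quotient.mk_eq_zero, ← Submodule.mkQ_apply, hz]
    refine inj1 (M1 K t) M1_anti M1_J z ?_
    intro j
    have e : v - ∑ a, ∑ b, rho t (z a b) (br (t a) (t b)) ∈ CC K t * CC K t := by
      rw [← Submodule.Quotient.mk_eq_zero, ← Submodule.mkQ_apply, map_sub, hz, map_sum, sub_eq_zero]
      refine Finset.sum_congr rfl fun a _ => ?_
      rw [map_sum]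
      rfl
    have e := E_C2 hs (E j j) (hE j j) e
    rw [map_sub, hv, map_sum, zero_sub, Matrix.neg_apply, neg_eq_zero, Matrix.sum_apply] at e
    rw [← e]
    refine Finset.sum_congr rfl fun a _ => ?_
    rw [map_sum, Matrix.sum_apply]
    refine Finset.sum_congr rfl fun b _ => ?_
    rw [E_rho hs (E j j) (hE j j)]
  obtain ⟨z, hz⟩ := C2_form hs h1 h2 s2
  rw [hz]
  refine inj2 (M2 K t) ?_ ?_ (M2_J1 h1 h2) (M2_J2 h1 h2) ?_ z ?_
  · intro a b c d p
    rw [M2_apply, M2_apply, br_anti (t a), map_neg, neg_mul]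
  · intro a b c d p
    rw [M2_apply, M2_apply, br_anti (t c), mul_neg]
  · intro a b c d p
    exact M2_S h1 h2 h3 p a b c d
  · intro j l
    have e := congrFun (congrFun (hv j l) 0) 2
    rw [hz] at e
    simp only [map_sum, Matrix.sum_apply, E_M2 hs (E j l) (hE j l), Matrix.zero_apply,
      Finset.sum_neg_distrib, neg_eq_zero] at e
    exact e

end core
end KZ

end SecE

noncomputable section SecG
namespace KG
variable (K : Type*) [Field K]

abbrev S4 := Matrix (Fin 4) (Fin 4) K
def Ya : S4 K := !![0,0,0,0; 1,0,0,0; 0,0,0,0; 0,0,1,0]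
def Yb : S4 K := !![0,0,0,0; 0,0,0,0; 1,0,0,0; 0,-1,0,0]
def Yab : S4 K := !![0,0,0,0; 0,0,0,0; 0,0,0,0; 1,0,0,0]

lemma Yaa : Ya K * Ya K = 0 := by
  ext i j; fin_cases i <;> fin_cases j <;> simp [Ya, Matrix.mul_apply, Fin.sum_univ_four]
lemma Ybb : Yb K * Yb K = 0 := by
  ext i j; fin_cases i <;> fin_cases j <;> simp [Yb, Matrix.mul_apply, Fin.sum_univ_four]
lemma Yab_eq : Ya K * Yb K = Yab K := by
  ext i j; fin_cases i <;> fin_cases j <;> simp [Ya, Yb, Yab, Matrix.mul_apply, Fin.sum_univ_four]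
lemma Yba_eq : Yb K * Ya K = - Yab K := by
  ext i j; fin_cases i <;> fin_cases j <;> simp [Ya, Yb, Yab, Matrix.mul_apply, Fin.sum_univ_four]
lemma Yaab : Ya K * Yab K = 0 := by rw [← Yab_eq, ← mul_assoc, Yaa, zero_mul]
lemma Yaba : Yab K * Ya K = 0 := by
  rw [← neg_neg (Yab K), ← Yba_eq, neg_mul, mul_assoc, Yaa, mul_zero, neg_zero]
lemma Ybab : Yb K * Yab K = 0 := by
  rw [← neg_neg (Yab K), ← Yba_eq, mul_neg, ← mul_assoc, Ybb, zero_mul, neg_zero]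
lemma Yabb : Yab K * Yb K = 0 := by rw [← Yab_eq, mul_assoc, Ybb, mul_zero]
lemma Yabab : Yab K * Yab K = 0 := by
  rw [← Yab_eq, ← mul_assoc, Yab_eq, Yaba, zero_mul]

def extHom : ExteriorAlgebra K (Fin 4 → K) →ₐ[K] S4 K :=
  ExteriorAlgebra.lift K ⟨(LinearMap.proj 2).smulRight (Ya K) + (LinearMap.proj 3).smulRight (Yb K), by
    intro m
    simp only [LinearMap.add_apply, LinearMap.smulRight_apply, LinearMap.proj_apply, add_mul, mul_add,
      smul_mul_assoc, mul_smul_comm, Yaa, Ybb, Yab_eq, Yba_eq]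
    module⟩

lemma extHom_ι (i : Fin 4) : extHom K (ExteriorAlgebra.ι K (Pi.single i 1)) =
    ![0, 0, Ya K, Yb K] i := by
  rw [extHom, ExteriorAlgebra.lift_ι_apply]
  fin_cases i <;> simp

def supHom : FreeSuperComm K →ₐ[K] S4 K :=
  Algebra.TensorProduct.lift ((Algebra.ofId K (S4 K)).comp (MvPolynomial.aeval ![1,0,0,0]))
    (extHom K) (fun x y => by
      rw [AlgHom.comp_apply]; exact Algebra.commutes _ _)

lemma supHom_x (i : Fin 4) : supHom K (xg K i) = algebraMap K _ (![1,0,0,0] i) := by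
  rw [supHom, xg, Algebra.TensorProduct.lift_tmul, AlgHom.comp_apply, MvPolynomial.aeval_X, map_one,
    mul_one]
  rfl

lemma supHom_y (i : Fin 4) : supHom K (yg K i) = ![0, 0, Ya K, Yb K] i := by
  rw [supHom, yg, Algebra.TensorProduct.lift_tmul, map_one, one_mul, extHom_ι]

def hh : Matrix (Fin 3) (Fin 3) K := !![1,0,0;0,0,0;0,0,1]
def NN : Matrix (Fin 3) (Fin 3) K := !![0,1,0;0,0,1;0,0,0]

def evC : FreeAlgebra K (Fin 2) →ₐ[K] Matrix (Fin 2) (Fin 2) (FreeSuperComm K) :=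
  FreeAlgebra.lift K ![genC₁ K, genC₂ K]
def evG : FreeAlgebra K (Fin 2) →ₐ[K] Matrix (Fin 3) (Fin 3) K :=
  FreeAlgebra.lift K ![hh K, NN K]

def toS : Matrix (Fin 2) (Fin 2) (FreeSuperComm K) →ₐ[K] Matrix (Fin 2) (Fin 2) (S4 K) :=
  (supHom K).mapMatrix

lemma rel (q : FreeAlgebra K (Fin 2)) : ∃ a a' μ ν s s' : K,
    toS K (evC K q) = !![a • 1 + s • Yab K, μ • Ya K; ν • Yb K, a' • 1 + s' • Yab K] ∧
    evG K q = !![a, μ, s; 0, a', ν; 0, 0, a] := by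
  induction q using FreeAlgebra.induction with
  | grade0 r =>
    refine ⟨r, r, 0, 0, 0, 0, ?_, ?_⟩
    · rw [AlgHom.commutes, AlgHom.commutes]
      ext1 i j; fin_cases i <;> fin_cases j <;>
        simp [Matrix.algebraMap_matrix_apply, Algebra.algebraMap_eq_smul_one]
    · rw [AlgHom.commutes]
      ext i j; fin_cases i <;> fin_cases j <;>
        simp [Matrix.algebraMap_matrix_apply]
  | grade1 i =>
    rw [evC, evG, FreeAlgebra.lift_ι_apply, FreeAlgebra.lift_ι_apply]
    fin_cases i
    · refine ⟨1, 0, 0, 0, 0, 0, ?_, ?_⟩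
      · ext1 i j; fin_cases i <;> fin_cases j <;> simp [toS, genC₁, supHom_x, supHom_y]
      · simp [hh]
    · refine ⟨0, 0, 1, 1, 0, 0, ?_, ?_⟩
      · ext1 i j; fin_cases i <;> fin_cases j <;> simp [toS, genC₂, supHom_x, supHom_y]
      · simp [NN]
  | mul p q hp hq =>
    obtain ⟨a, a', μ, ν, s, s', h1, h2⟩ := hp
    obtain ⟨b, b', μ', ν', r, r', h3, h4⟩ := hq
    refine ⟨a * b, a' * b', a * μ' + μ * b', ν * b + a' * ν', a * r + μ * ν' + s * b,
      a' * r' - ν * μ' + s' * b', ?_, ?_⟩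
    · rw [map_mul, map_mul, h1, h3]
      ext1 i j; fin_cases i <;> fin_cases j <;>
        simp [Matrix.mul_apply, Fin.sum_univ_two, add_mul, mul_add, Yab_eq, Yba_eq, Yaab, Yaba, Ybab, Yabb, Yabab] <;> module
    · rw [map_mul, h2, h4]
      ext i j; fin_cases i <;> fin_cases j <;>
        simp [Matrix.mul_apply, Fin.sum_univ_three] <;> ring
  | add p q hp hq =>
    obtain ⟨a, a', μ, ν, s, s', h1, h2⟩ := hp
    obtain ⟨b, b', μ', ν', r, r', h3, h4⟩ := hq
    refine ⟨a + b, a' + b', μ + μ', ν + ν', s + r, s' + r', ?_, ?_⟩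
    · rw [map_add, map_add, h1, h3]
      ext1 i j; fin_cases i <;> fin_cases j <;> simp <;> module
    · rw [map_add, h2, h4]
      ext i j; fin_cases i <;> fin_cases j <;> simp

lemma rel0 (q : FreeAlgebra K (Fin 2)) (hq : evC K q = 0) : evG K q = 0 := by
  obtain ⟨a, a', μ, ν, s, s', h1, h2⟩ := rel K q
  rw [hq, map_zero] at h1
  have f (i j k l) := congrFun (congrFun (congrFun (congrFun h1 i) j) k) l
  have e1 := f 0 0 0 0
  have e2 := f 0 0 3 0
  have e3 := f 0 1 1 0
  have e4 := f 1 0 2 0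
  have e5 := f 1 1 0 0
  simp [Ya, Yb, Yab] at e1 e2 e3 e4 e5
  rw [h2, ← e1, ← e2, ← e3, ← e4, ← e5]
  ext i j; fin_cases i <;> fin_cases j <;> simp

lemma evC_mem (q : FreeAlgebra K (Fin 2)) : evC K q ∈ Falg K := by
  induction q using FreeAlgebra.induction with
  | grade0 r => rw [AlgHom.commutes]; exact Subalgebra.algebraMap_mem _ _
  | grade1 i =>
    rw [evC, FreeAlgebra.lift_ι_apply]
    apply Algebra.subset_adjoin
    fin_cases i <;> simp
  | mul a b ha hb => rw [map_mul]; exact mul_mem ha hb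
  | add a b ha hb => rw [map_add]; exact add_mem ha hb

lemma evC_surj (m) (hm : m ∈ Falg K) : ∃ q, evC K q = m := by
  have : Falg K ≤ (evC K).range := by
    rw [Falg, Algebra.adjoin_le_iff]
    rintro _ (rfl | rfl)
    · exact ⟨FreeAlgebra.ι K 0, by simp [evC]⟩
    · exact ⟨FreeAlgebra.ι K 1, by simp [evC]⟩
  exact this hm

theorem TG0 {f : FreeAlgebra K ℕ} (hf : f ∈ polyIdentities K (Falg K)) (a a' μ ν : ℕ → K) :
    FreeAlgebra.lift K (fun n => !![a n, μ n, 0; 0, a' n, ν n; 0, 0, a n]) f = 0 := by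
  let x : FreeAlgebra K (Fin 2) := FreeAlgebra.ι K 0
  let y : FreeAlgebra K (Fin 2) := FreeAlgebra.ι K 1
  let Q : FreeAlgebra K ℕ →ₐ[K] FreeAlgebra K (Fin 2) := FreeAlgebra.lift K
    (fun n => a n • x + a' n • (1 - x) + μ n • (x * y) + ν n • ((1 - x) * y))
  have h := hf (((evC K).codRestrict (Falg K) (evC_mem K)).comp Q)
  have h : evC K (Q f) = 0 := congrArg Subtype.val h
  have h := rel0 K _ h
  rw [← AlgHom.comp_apply] at h
  rw [← h]
  congr 1
  apply FreeAlgebra.hom_ext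
  ext n : 1
  simp only [Function.comp_apply, FreeAlgebra.lift_ι_apply, AlgHom.comp_apply, Q, map_add, map_smul,
    map_mul, map_sub, map_one, x, y, evG, sub_mul, one_mul]
  ext i j; fin_cases i <;> fin_cases j <;> simp [hh, NN]

theorem TG [Infinite K] {σ : Type*} {f : FreeAlgebra K ℕ} (hf : f ∈ polyIdentities K (Falg K))
    (a a' μ ν : ℕ → MvPolynomial σ K) :
    FreeAlgebra.lift K (fun n => !![a n, μ n, 0; 0, a' n, ν n; 0, 0, a n]) f = 0 := by
  ext1 i j
  rw [Matrix.zero_apply]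
  apply MvPolynomial.funext
  intro P
  rw [map_zero]
  have h := TG0 K hf (fun n => MvPolynomial.aeval P (a n)) (fun n => MvPolynomial.aeval P (a' n))
    (fun n => MvPolynomial.aeval P (μ n)) (fun n => MvPolynomial.aeval P (ν n))
  have e : FreeAlgebra.lift K (fun n => !![MvPolynomial.aeval P (a n), MvPolynomial.aeval P (μ n), 0;
      0, MvPolynomial.aeval P (a' n), MvPolynomial.aeval P (ν n); 0, 0, MvPolynomial.aeval P (a n)]) =
    ((MvPolynomial.aeval P : MvPolynomial σ K →ₐ[K] K).mapMatrix).comp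
      (FreeAlgebra.lift K (fun n => !![a n, μ n, 0; 0, a' n, ν n; 0, 0, a n])) := by
    apply FreeAlgebra.hom_ext
    ext n : 1
    simp only [Function.comp_apply, FreeAlgebra.lift_ι_apply, AlgHom.comp_apply]
    ext i j; fin_cases i <;> fin_cases j <;> simp
  rw [e] at h
  have := congrFun (congrFun h i) j
  rw [← MvPolynomial.coe_aeval_eq_eval]
  exact this

end KG

end SecG

noncomputable section SecP
set_option linter.unusedSimpArgs false
set_option linter.unnecessarySeqFocus false
set_option linter.flexible false
namespace KP

structure Sup (Z R : Type*) [CommRing Z] [Ring R] [Algebra Z R] where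
  (y1 y2 z1 z2 : R)
  (e11 e12 e21 e22 x1 x2 x1' x2' : Z)
  y11 : y1 * y1 = 0
  y22 : y2 * y2 = 0
  z11 : z1 * z1 = 0
  z22 : z2 * z2 = 0
  y21 : y2 * y1 = - (y1 * y2)
  z21 : z2 * z1 = - (z1 * z2)
  zy11 : z1 * y1 = - (y1 * z1)
  zy12 : z1 * y2 = - (y2 * z1)
  zy21 : z2 * y1 = - (y1 * z2)
  zy22 : z2 * y2 = - (y2 * z2)
  he11 : algebraMap Z R e11 = y1 * z1
  he12 : algebraMap Z R e12 = y1 * z2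
  he21 : algebraMap Z R e21 = y2 * z1
  he22 : algebraMap Z R e22 = y2 * z2

namespace Sup
variable {Z R : Type*} [CommRing Z] [Ring R] [Algebra Z R] (s : Sup Z R)

lemma y11' (w : R) : s.y1 * (s.y1 * w) = 0 := by rw [← mul_assoc, s.y11, zero_mul]
lemma y22' (w : R) : s.y2 * (s.y2 * w) = 0 := by rw [← mul_assoc, s.y22, zero_mul]
lemma z11' (w : R) : s.z1 * (s.z1 * w) = 0 := by rw [← mul_assoc, s.z11, zero_mul]
lemma z22' (w : R) : s.z2 * (s.z2 * w) = 0 := by rw [← mul_assoc, s.z22, zero_mul]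
lemma y21' (w : R) : s.y2 * (s.y1 * w) = - (s.y1 * (s.y2 * w)) := by
  rw [← mul_assoc, s.y21, neg_mul, mul_assoc]
lemma z21' (w : R) : s.z2 * (s.z1 * w) = - (s.z1 * (s.z2 * w)) := by
  rw [← mul_assoc, s.z21, neg_mul, mul_assoc]
lemma zy11' (w : R) : s.z1 * (s.y1 * w) = - (s.y1 * (s.z1 * w)) := by
  rw [← mul_assoc, s.zy11, neg_mul, mul_assoc]
lemma zy12' (w : R) : s.z1 * (s.y2 * w) = - (s.y2 * (s.z1 * w)) := by
  rw [← mul_assoc, s.zy12, neg_mul, mul_assoc]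
lemma zy21' (w : R) : s.z2 * (s.y1 * w) = - (s.y1 * (s.z2 * w)) := by
  rw [← mul_assoc, s.zy21, neg_mul, mul_assoc]
lemma zy22' (w : R) : s.z2 * (s.y2 * w) = - (s.y2 * (s.z2 * w)) := by
  rw [← mul_assoc, s.zy22, neg_mul, mul_assoc]

attribute [local simp] y11' y22' z11' z22' y21' z21' zy11' zy12' zy21' zy22' y11 y22 z11 z22 y21 z21
  zy11 zy12 zy21 zy22

def X1 : Z := s.x1 - s.x1'
def X2 : Z := s.x2 - s.x2'

def T1 : R := s.y1 * (s.y2 * s.z1)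
def T2 : R := s.y1 * (s.y2 * s.z2)
def S1 : R := s.y1 * (s.z1 * s.z2)
def S2 : R := s.y2 * (s.z1 * s.z2)
def YY : R := s.y1 * (s.y2 * (s.z1 * s.z2))

def N (n : Z) : Prop := n • s.T1 = 0 ∧ n • s.T2 = 0 ∧ n • s.S1 = 0 ∧ n • s.S2 = 0 ∧ n • s.YY = 0

variable {s}
lemma N.add {n m : Z} (h : s.N n) (k : s.N m) : s.N (n + m) := by
  obtain ⟨a, b, c, d, e⟩ := h
  obtain ⟨a', b', c', d', e'⟩ := k
  refine ⟨?_, ?_, ?_, ?_, ?_⟩ <;> simp [add_smul, *]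
lemma N.mul {n : Z} (h : s.N n) (m : Z) : s.N (m * n) := by
  obtain ⟨a, b, c, d, e⟩ := h
  refine ⟨?_, ?_, ?_, ?_, ?_⟩ <;> simp [mul_smul, *]
variable (s)
lemma N0 : s.N 0 := by simp [N]
lemma N11 : s.N s.e11 := by
  refine ⟨?_, ?_, ?_, ?_, ?_⟩ <;> rw [Algebra.smul_def, s.he11] <;>
   simp [T1, T2, S1, S2, YY, mul_assoc]
lemma N12 : s.N s.e12 := by
  refine ⟨?_, ?_, ?_, ?_, ?_⟩ <;> rw [Algebra.smul_def, s.he12] <;>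
   simp [T1, T2, S1, S2, YY, mul_assoc]
lemma N21 : s.N s.e21 := by
  refine ⟨?_, ?_, ?_, ?_, ?_⟩ <;> rw [Algebra.smul_def, s.he21] <;>
   simp [T1, T2, S1, S2, YY, mul_assoc]
lemma N22 : s.N s.e22 := by
  refine ⟨?_, ?_, ?_, ?_, ?_⟩ <;> rw [Algebra.smul_def, s.he22] <;>
   simp [T1, T2, S1, S2, YY, mul_assoc]

def mat (α g1 g2 k1 k2 δ : Z) : Matrix (Fin 2) (Fin 2) R :=
  !![α • 1, g1 • s.y1 + g2 • s.y2; k1 • s.z1 + k2 • s.z2, δ • 1]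

def ef (g1 g2 k1 k2 : Z) : Z :=
  g1 * k1 * s.e11 + g1 * k2 * s.e12 + g2 * k1 * s.e21 + g2 * k2 * s.e22

lemma ef_yz (g1 g2 k1 k2 : Z) : (g1 • s.y1 + g2 • s.y2) * (k1 • s.z1 + k2 • s.z2) =
    s.ef g1 g2 k1 k2 • 1 := by
  rw [← Algebra.algebraMap_eq_smul_one]
  simp only [ef, map_add, map_mul, s.he11, s.he12, s.he21, s.he22, add_mul, mul_add,
    smul_mul_assoc, mul_smul_comm]
  simp only [mul_assoc, ← Algebra.smul_def, smul_mul_assoc]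
  module
lemma ef_zy (g1 g2 k1 k2 : Z) : (k1 • s.z1 + k2 • s.z2) * (g1 • s.y1 + g2 • s.y2) =
    - s.ef g1 g2 k1 k2 • 1 := by
  have h : (k1 • s.z1 + k2 • s.z2) * (g1 • s.y1 + g2 • s.y2) =
      - ((g1 • s.y1 + g2 • s.y2) * (k1 • s.z1 + k2 • s.z2)) := by
    simp only [add_mul, mul_add, smul_mul_assoc, mul_smul_comm, s.zy11, s.zy12, s.zy21, s.zy22,
      smul_neg]
    module
  rw [h, s.ef_yz, neg_smul]

lemma mat_mul (α g1 g2 k1 k2 δ α' g1' g2' k1' k2' δ' : Z) :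
    s.mat α g1 g2 k1 k2 δ * s.mat α' g1' g2' k1' k2' δ' =
    s.mat (α * α' + s.ef g1 g2 k1' k2') (α * g1' + g1 * δ') (α * g2' + g2 * δ')
      (k1 * α' + δ * k1') (k2 * α' + δ * k2') (δ * δ' - s.ef g1' g2' k1 k2) := by
  have h1 := s.ef_yz g1 g2 k1' k2'
  have h2 := s.ef_zy g1' g2' k1 k2
  unfold mat
  rw [Matrix.mul_fin_two, h1, h2]
  ext i j; fin_cases i <;> fin_cases j <;> simp <;> module

def Good (M : Matrix (Fin 2) (Fin 2) R) : Prop :=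
  ∃ α δ g1 g2 k1 k2 l n r1 r2 : Z, s.N n ∧ s.N r1 ∧ s.N r2 ∧
    α - δ = g1 * s.X1 + g2 * s.X2 + n ∧ k1 = g1 + l * s.X2 + r1 ∧ k2 = g2 - l * s.X1 + r2 ∧
    M = s.mat α g1 g2 k1 k2 δ

variable {s}
lemma Good.mul {M M'} (h : s.Good M) (h' : s.Good M') : s.Good (M * M') := by
  obtain ⟨α, δ, g1, g2, k1, k2, l, n, r1, r2, hn, hr1, hr2, hD, hk1, hk2, rfl⟩ := h
  obtain ⟨α', δ', g1', g2', k1', k2', l', n', r1', r2', hn', hr1', hr2', hD', hk1', hk2', rfl⟩ := h'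
  have Ne : ∀ a b c d, s.N (s.ef a b c d) := fun a b c d =>
    ((((s.N11).mul _).add (s.N12.mul _)).add (s.N21.mul _)).add (s.N22.mul _)
  have hm : s.N (n + (-s.X1) * r1 + (-s.X2) * r2) := (hn.add (hr1.mul _)).add (hr2.mul _)
  refine ⟨_, _, _, _, _, _, l * δ' + δ * l' + (k1 * g2' - k2 * g1'),
    α * n' + δ' * n + (s.ef g1 g2 k1' k2' + s.ef g1' g2' k1 k2),
    k1 * n' + (-g1') * (n + (-s.X1) * r1 + (-s.X2) * r2) + (δ' * r1 + δ * r1'),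
    k2 * n' + (-g2') * (n + (-s.X1) * r1 + (-s.X2) * r2) + (δ' * r2 + δ * r2'),
    ((hn'.mul _).add (hn.mul _)).add ((Ne _ _ _ _).add (Ne _ _ _ _)),
    ((hn'.mul _).add (hm.mul _)).add ((hr1.mul _).add (hr1'.mul _)),
    ((hn'.mul _).add (hm.mul _)).add ((hr2.mul _).add (hr2'.mul _)), ?_, ?_, ?_, mat_mul _ _ _ _ _ _ _ _ _ _ _ _ _⟩
  · linear_combination δ' * hD + α * hD'
  · subst hk1 hk2 hk1' hk2'
    linear_combination (g1 + l * s.X2 + r1) * hD' - g1' * hD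
  · subst hk1 hk2 hk1' hk2'
    linear_combination (g2 - l * s.X1 + r2) * hD' - g2' * hD

lemma Good.add {M M'} (h : s.Good M) (h' : s.Good M') : s.Good (M + M') := by
  obtain ⟨α, δ, g1, g2, k1, k2, l, n, r1, r2, hn, hr1, hr2, hD, hk1, hk2, rfl⟩ := h
  obtain ⟨α', δ', g1', g2', k1', k2', l', n', r1', r2', hn', hr1', hr2', hD', hk1', hk2', rfl⟩ := h'
  refine ⟨α + α', δ + δ', g1 + g1', g2 + g2', k1 + k1', k2 + k2', l + l', n + n', r1 + r1', r2 + r2',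
    hn.add hn', hr1.add hr1', hr2.add hr2', ?_, ?_, ?_, ?_⟩
  · linear_combination hD + hD'
  · linear_combination hk1 + hk1'
  · linear_combination hk2 + hk2'
  · ext i j; fin_cases i <;> fin_cases j <;> simp [mat] <;> module

variable (s)
lemma Good.scal (z : Z) : s.Good (s.mat z 0 0 0 0 z) :=
  ⟨z, z, 0, 0, 0, 0, 0, 0, 0, 0, s.N0, s.N0, s.N0, by ring, by ring, by ring, rfl⟩

def D1 := s.mat s.x1 1 0 1 0 s.x1'
def D2 := s.mat s.x2 0 1 0 1 s.x2'
lemma Good.D1 : s.Good s.D1 :=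
  ⟨_, _, _, _, _, _, 0, 0, 0, 0, s.N0, s.N0, s.N0, by unfold X1; ring, by ring, by ring, rfl⟩
lemma Good.D2 : s.Good s.D2 :=
  ⟨_, _, _, _, _, _, 0, 0, 0, 0, s.N0, s.N0, s.N0, by unfold X2; ring, by ring, by ring, rfl⟩

def c0 : Matrix (Fin 2) (Fin 2) R :=
  !![s.y1 * s.z2 - s.y2 * s.z1, s.X1 • s.y2 - s.X2 • s.y1;
    - (s.X1 • s.z2) + s.X2 • s.z1, s.y1 * s.z2 - s.y2 * s.z1]

lemma c0_eq : br s.D1 s.D2 = s.c0 := by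
  unfold br D1 D2 mat c0 X1 X2
  rw [Matrix.mul_fin_two, Matrix.mul_fin_two]
  ext i j; fin_cases i <;> fin_cases j <;>
    simp [s.zy11, s.zy12, s.zy21, s.zy22] <;> module

lemma m2 {R : Type*} {a b c d a' b' c' d' : R} (h1 : a = a') (h2 : b = b') (h3 : c = c')
    (h4 : d = d') : !![a, b; c, d] = !![a', b'; c', d'] := by rw [h1, h2, h3, h4]

set_option maxHeartbeats 1000000 in
lemma c0_cent (α g1 g2 k1 k2 δ : Z) : s.c0 * s.mat α g1 g2 k1 k2 δ * s.c0 * s.D1 =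
    s.D1 * (s.c0 * s.mat α g1 g2 k1 k2 δ * s.c0) := by
  unfold c0 D1 mat
  simp only [Matrix.mul_fin_two]
  apply m2 <;>
  · simp only [X1, smul_mul_assoc, mul_smul_comm, mul_one, one_mul, mul_zero, zero_mul, smul_zero,
      add_mul, mul_add, sub_mul, mul_sub, mul_assoc, neg_mul, mul_neg, smul_neg, neg_neg,
      smul_add, smul_sub, neg_zero, add_zero, zero_add, sub_zero, zero_sub, one_smul, zero_smul,
      y11', y22', z11', z22', y21', z21', zy11', zy12', zy21', zy22', y11, y22, z11, z22, y21,
      z21, zy11, zy12, zy21, zy22]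
    module

set_option maxHeartbeats 1000000 in
lemma c0_cent2 (α g1 g2 k1 k2 δ : Z) : s.c0 * s.mat α g1 g2 k1 k2 δ * s.c0 * s.D2 =
    s.D2 * (s.c0 * s.mat α g1 g2 k1 k2 δ * s.c0) := by
  unfold c0 D2 mat
  simp only [Matrix.mul_fin_two]
  apply m2 <;>
  · simp only [X2, smul_mul_assoc, mul_smul_comm, mul_one, one_mul, mul_zero, zero_mul, smul_zero,
      add_mul, mul_add, sub_mul, mul_sub, mul_assoc, neg_mul, mul_neg, smul_neg, neg_neg,
      smul_add, smul_sub, neg_zero, add_zero, zero_add, sub_zero, zero_sub, one_smul, zero_smul,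
      y11', y22', z11', z22', y21', z21', zy11', zy12', zy21', zy22', y11, y22, z11, z22, y21,
      z21, zy11, zy12, zy21, zy22]
    module

set_option maxHeartbeats 1000000 in
lemma c0_zero (α g1 g2 k1 k2 δ : Z) : s.c0 * s.mat α g1 g2 k1 k2 δ * s.c0 * s.c0 = 0 := by
  have e0 : (0 : Matrix (Fin 2) (Fin 2) R) = !![0, 0; 0, 0] := by
    ext i j; fin_cases i <;> fin_cases j <;> rfl
  rw [e0]
  unfold c0 mat
  simp only [Matrix.mul_fin_two]
  apply m2 <;>
  · simp only [smul_mul_assoc, mul_smul_comm, mul_one, one_mul, mul_zero, zero_mul, smul_zero, add_mul,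
      mul_add, sub_mul, mul_sub, mul_assoc, neg_mul, mul_neg, smul_neg, neg_neg, smul_add,
      smul_sub, neg_zero, add_zero, zero_add, sub_zero, zero_sub, one_smul, zero_smul, y11',
      y22', z11', z22', y21', z21', zy11', zy12', zy21', zy22', y11, y22, z11, z22, y21, z21,
      zy11, zy12, zy21, zy22]
    module

end Sup
end KP

end SecP

noncomputable section SecQ
set_option linter.unusedSimpArgs false
set_option linter.unnecessarySeqFocus false
set_option linter.flexible false
namespace KP
namespace Sup
variable {Z R : Type*} [CommRing Z] [Ring R] [Algebra Z R] (s : Sup Z R)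

attribute [local simp] y11' y22' z11' z22' y21' z21' zy11' zy12' zy21' zy22' y11 y22 z11 z22 y21 z21
  zy11 zy12 zy21 zy22

def JJ : Ideal Z where
  carrier := {n | s.N n}
  add_mem' := fun h k => N.add h k
  zero_mem' := s.N0
  smul_mem' := fun m _ h => N.mul h m

def u4 (p1 p2 p3 p4 : Z) : Z := p1 * s.e11 + p2 * s.e12 + p3 * s.e21 + p4 * s.e22

lemma uu (p1 p2 p3 p4 q1 q2 q3 q4 : Z) : (s.u4 p1 p2 p3 p4 * s.u4 q1 q2 q3 q4) • (1 : R) =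
    (- (p1 * q4 + p4 * q1 - p2 * q3 - p3 * q2)) • s.YY := by
  rw [← Algebra.algebraMap_eq_smul_one]
  simp only [u4, map_mul, map_add, s.he11, s.he12, s.he21, s.he22, ← Algebra.smul_def]
  simp [YY, add_mul, mul_add, mul_assoc]
  module

lemma uy1 (p1 p2 p3 p4 : Z) : (s.u4 p1 p2 p3 p4) • s.y1 = p3 • s.T1 + p4 • s.T2 := by
  rw [Algebra.smul_def]
  simp only [u4, map_mul, map_add, s.he11, s.he12, s.he21, s.he22, ← Algebra.smul_def]
  simp [T1, T2, add_mul, mul_add, mul_assoc]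
lemma uy2 (p1 p2 p3 p4 : Z) : (s.u4 p1 p2 p3 p4) • s.y2 = (-p1) • s.T1 + (-p2) • s.T2 := by
  rw [Algebra.smul_def]
  simp only [u4, map_mul, map_add, s.he11, s.he12, s.he21, s.he22, ← Algebra.smul_def]
  simp [T1, T2, add_mul, mul_add, mul_assoc]
lemma uz1 (p1 p2 p3 p4 : Z) : (s.u4 p1 p2 p3 p4) • s.z1 = (-p2) • s.S1 + (-p4) • s.S2 := by
  rw [Algebra.smul_def]
  simp only [u4, map_mul, map_add, s.he11, s.he12, s.he21, s.he22, ← Algebra.smul_def]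
  simp [S1, S2, add_mul, mul_add, mul_assoc]
lemma uz2 (p1 p2 p3 p4 : Z) : (s.u4 p1 p2 p3 p4) • s.z2 = p1 • s.S1 + p3 • s.S2 := by
  rw [Algebra.smul_def]
  simp only [u4, map_mul, map_add, s.he11, s.he12, s.he21, s.he22, ← Algebra.smul_def]
  simp [S1, S2, add_mul, mul_add, mul_assoc]

structure Dat (s : Sup Z R) where
  (α δ g1 g2 k1 k2 l n r1 r2 : Z)
  hn : s.N n
  hr1 : s.N r1
  hr2 : s.N r2
  hD : α - δ = g1 * s.X1 + g2 * s.X2 + n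
  hk1 : k1 = g1 + l * s.X2 + r1
  hk2 : k2 = g2 - l * s.X1 + r2

variable {s}
namespace Dat
def m (a : Dat s) := s.mat a.α a.g1 a.g2 a.k1 a.k2 a.δ
def U1 (a b : Dat s) : Z := a.g1 * b.k1 - b.g1 * a.k1
def U2 (a b : Dat s) : Z := a.g1 * b.k2 - b.g1 * a.k2
def U3 (a b : Dat s) : Z := a.g2 * b.k1 - b.g2 * a.k1
def U4 (a b : Dat s) : Z := a.g2 * b.k2 - b.g2 * a.k2
def D (a : Dat s) : Z := a.α - a.δ
def V1 (a b : Dat s) : Z := a.D * b.g1 - b.D * a.g1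
def V2 (a b : Dat s) : Z := a.D * b.g2 - b.D * a.g2
def W1 (a b : Dat s) : Z := - (a.D * b.k1 - b.D * a.k1)
def W2 (a b : Dat s) : Z := - (a.D * b.k2 - b.D * a.k2)
def U (a b : Dat s) : Z := s.u4 (U1 a b) (U2 a b) (U3 a b) (U4 a b)

lemma mat_sub (a b c d e f a' b' c' d' e' f' : Z) : s.mat a b c d e f - s.mat a' b' c' d' e' f' =
    s.mat (a - a') (b - b') (c - c') (d - d') (e - e') (f - f') := by
  ext i j; fin_cases i <;> fin_cases j <;> simp [mat] <;> module
lemma mat_add (a b c d e f a' b' c' d' e' f' : Z) : s.mat a b c d e f + s.mat a' b' c' d' e' f' =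
    s.mat (a + a') (b + b') (c + c') (d + d') (e + e') (f + f') := by
  ext i j; fin_cases i <;> fin_cases j <;> simp [mat] <;> module

lemma br_m (a b : Dat s) : br a.m b.m =
    s.mat (U a b) (V1 a b) (V2 a b) (W1 a b) (W2 a b) (U a b) := by
  unfold br m
  rw [mat_mul, mat_mul, mat_sub]
  congr 1 <;> simp only [U, u4, U1, U2, U3, U4, V1, V2, W1, W2, D, ef] <;> ring

/-- signed sum -/
def SS {M : Type*} [AddCommGroup M] (f : Dat s → Dat s → Dat s → Dat s → M) (a b c d : Dat s) : M :=
  f a b c d + f c d a b - f a c b d - f b d a c + f a d b c + f b c a d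

lemma kil {M : Type*} [AddCommGroup M] [Module Z M] (t : M) (ht : ∀ n, s.N n → n • t = 0) {c : Z}
    (hc : Ideal.Quotient.mk s.JJ c = 0) : c • t = 0 :=
  ht c (Ideal.Quotient.eq_zero_iff_mem.1 hc)

lemma qD (a : Dat s) : Ideal.Quotient.mk s.JJ a.D = Ideal.Quotient.mk s.JJ (a.g1 * s.X1 + a.g2 * s.X2) := by
  rw [Ideal.Quotient.eq, D, a.hD, add_sub_cancel_left]; exact a.hn
lemma q1 (a : Dat s) : Ideal.Quotient.mk s.JJ a.k1 = Ideal.Quotient.mk s.JJ (a.g1 + a.l * s.X2) := by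
  rw [Ideal.Quotient.eq, a.hk1, add_sub_cancel_left]; exact a.hr1
lemma q2 (a : Dat s) : Ideal.Quotient.mk s.JJ a.k2 = Ideal.Quotient.mk s.JJ (a.g2 - a.l * s.X1) := by
  rw [Ideal.Quotient.eq, a.hk2, add_sub_cancel_left]; exact a.hr2

lemma t1 (n : Z) (h : s.N n) : n • s.T1 = 0 := h.1
lemma t2 (n : Z) (h : s.N n) : n • s.T2 = 0 := h.2.1
lemma t3 (n : Z) (h : s.N n) : n • s.S1 = 0 := h.2.2.1
lemma t4 (n : Z) (h : s.N n) : n • s.S2 = 0 := h.2.2.2.1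
lemma t5 (n : Z) (h : s.N n) : n • s.YY = 0 := h.2.2.2.2

lemma SUU (a b c d : Dat s) : SS (fun i j k l => U i j * U k l) a b c d • (1 : R) = 0 := by
  simp only [SS, U, add_smul, sub_smul, uu]
  simp only [← add_smul, ← sub_smul]
  apply kil _ t5
  simp only [U1, U2, U3, U4, map_add, map_sub, map_mul, map_neg, qD, q1, q2]
  ring
lemma SVW1 (a b c d : Dat s) :
    SS (fun i j k l => s.ef (V1 i j) (V2 i j) (W1 k l) (W2 k l)) a b c d = 0 := by
  simp only [SS, ef, V1, V2, W1, W2]; ring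
lemma SVW2 (a b c d : Dat s) :
    SS (fun i j k l => s.ef (V1 k l) (V2 k l) (W1 i j) (W2 i j)) a b c d = 0 := by
  simp only [SS, ef, V1, V2, W1, W2]; ring

lemma SUV (a b c d : Dat s) : SS (fun i j k l => U i j * V1 k l) a b c d • s.y1 +
    SS (fun i j k l => U i j * V2 k l) a b c d • s.y2 = 0 := by
  have e : ∀ a b c d : Dat s, SS (fun i j k l => U i j * V1 k l) a b c d • s.y1 +
    SS (fun i j k l => U i j * V2 k l) a b c d • s.y2 =
    SS (fun i j k l => V1 k l * U3 i j - V2 k l * U1 i j) a b c d • s.T1 +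
    SS (fun i j k l => V1 k l * U4 i j - V2 k l * U2 i j) a b c d • s.T2 := by
    intro a b c d
    simp only [SS, U, mul_comm (u4 _ _ _ _ _), add_smul, sub_smul, mul_smul, uy1, uy2]
    module
  rw [e]
  refine (congrArg₂ (· + ·) (kil s.T1 t1 ?_) (kil s.T2 t2 ?_)).trans (add_zero (0 : R)) <;>
  · simp only [SS, U1, U2, U3, U4, V1, V2, map_add, map_sub, map_mul, map_neg, qD, q1, q2]
    ring
lemma SUW (a b c d : Dat s) : SS (fun i j k l => U i j * W1 k l) a b c d • s.z1 +
    SS (fun i j k l => U i j * W2 k l) a b c d • s.z2 = 0 := by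
  have e : ∀ a b c d : Dat s, SS (fun i j k l => U i j * W1 k l) a b c d • s.z1 +
    SS (fun i j k l => U i j * W2 k l) a b c d • s.z2 =
    SS (fun i j k l => - W1 k l * U2 i j + W2 k l * U1 i j) a b c d • s.S1 +
    SS (fun i j k l => - W1 k l * U4 i j + W2 k l * U3 i j) a b c d • s.S2 := by
    intro a b c d
    simp only [SS, U, mul_comm (u4 _ _ _ _ _), add_smul, sub_smul, mul_smul, uz1, uz2]
    module
  rw [e]
  refine (congrArg₂ (· + ·) (kil s.S1 t3 ?_) (kil s.S2 t4 ?_)).trans (add_zero (0 : R)) <;>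
  · simp only [SS, U1, U2, U3, U4, W1, W2, map_add, map_sub, map_mul, map_neg, qD, q1, q2]
    ring

lemma h3m (a b c d : Dat s) :
    br a.m b.m * br c.m d.m + br c.m d.m * br a.m b.m - br a.m c.m * br b.m d.m
      - br b.m d.m * br a.m c.m + br a.m d.m * br b.m c.m + br b.m c.m * br a.m d.m = 0 := by
  simp only [br_m, mat_mul, mat_add, mat_sub]
  have e : ∀ P Q1 Q2 R1 R2 P' : Z, P • (1 : R) = 0 → Q1 • s.y1 + Q2 • s.y2 = 0 →
      R1 • s.z1 + R2 • s.z2 = 0 → P' • (1 : R) = 0 → s.mat P Q1 Q2 R1 R2 P' = 0 := by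
    intro P Q1 Q2 R1 R2 P' h1 h2 h3 h4
    rw [mat, h1, h2, h3, h4]
    ext i j; fin_cases i <;> fin_cases j <;> rfl
  have f1 := SUU a b c d
  have f2 := SVW1 a b c d
  have f3 := SVW2 a b c d
  have f4 := SUV a b c d
  have f5 := SUW a b c d
  apply e
  · have := congrArg (· • (1 : R)) f2
    simp only [SS, zero_smul] at *
    have h := congrArg₂ (· + ·) f1 this
    simp only [add_zero] at h
    rw [← h]
    module
  · have h := congrArg (fun x => x + x) f4
    simp only [SS, add_zero] at *
    rw [← h]
    module
  · have h := congrArg (fun x => x + x) f5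
    simp only [SS, add_zero] at *
    rw [← h]
    module
  · have := congrArg (· • (1 : R)) f3
    simp only [SS, zero_smul] at *
    have h := congrArg₂ (· - ·) f1 this
    simp only [sub_zero] at h
    rw [← h]
    module

end Dat
variable (s)
lemma Good.h3 {A B C D} (ha : s.Good A) (hb : s.Good B) (hc : s.Good C) (hd : s.Good D) :
    br A B * br C D + br C D * br A B - br A C * br B D
      - br B D * br A C + br A D * br B C + br B C * br A D = 0 := by
  have key : ∀ {M}, s.Good M → ∃ d : Dat s, M = d.m := by
    rintro M ⟨α, δ, g1, g2, k1, k2, l, n, r1, r2, hn, hr1, hr2, hD, hk1, hk2, rfl⟩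
    exact ⟨⟨α, δ, g1, g2, k1, k2, l, n, r1, r2, hn, hr1, hr2, hD, hk1, hk2⟩, rfl⟩
  obtain ⟨a, rfl⟩ := key ha
  obtain ⟨b, rfl⟩ := key hb
  obtain ⟨c, rfl⟩ := key hc
  obtain ⟨d, rfl⟩ := key hd
  exact Dat.h3m a b c d
end Sup
end KP

end SecQ

noncomputable section SecH
set_option linter.unusedSimpArgs false
set_option linter.unnecessarySeqFocus false
set_option linter.flexible false
namespace KH
open TensorProduct

@[reducible] def zalg (R : Type*) [Ring R] : Algebra (Subring.center R) R where
  algebraMap := (Subring.center R).subtype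
  commutes' := fun r x => ((Subring.mem_center_iff.1 r.2) x).symm
  smul_def' := fun _ _ => rfl

variable (K : Type*) [Field K]

lemma ea_anti (a b : Fin 4 → K) : ExteriorAlgebra.ι K a * ExteriorAlgebra.ι K b =
    - (ExteriorAlgebra.ι K b * ExteriorAlgebra.ι K a) := by
  rw [eq_neg_iff_add_eq_zero]; exact ExteriorAlgebra.ι_add_mul_swap a b

lemma ea_comm (a b : Fin 4 → K) (w : ExteriorAlgebra K (Fin 4 → K)) :
    w * (ExteriorAlgebra.ι K a * ExteriorAlgebra.ι K b) =
    (ExteriorAlgebra.ι K a * ExteriorAlgebra.ι K b) * w := by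
  induction w using ExteriorAlgebra.induction with
  | algebraMap r => exact Algebra.commutes r _
  | ι c =>
    rw [← mul_assoc, ea_anti K c a, neg_mul, mul_assoc, ea_anti K c b, mul_neg, neg_neg, mul_assoc]
  | mul x y hx hy => rw [mul_assoc, hy, ← mul_assoc, hx, mul_assoc]
  | add x y hx hy => rw [add_mul, mul_add, hx, hy]

lemma yg_anti (i j : Fin 4) : yg K i * yg K j = - (yg K j * yg K i) := by
  simp only [yg, Algebra.TensorProduct.tmul_mul_tmul, mul_one]
  rw [ea_anti, TensorProduct.tmul_neg]
lemma yg_sq (i : Fin 4) : yg K i * yg K i = 0 := by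
  simp only [yg, Algebra.TensorProduct.tmul_mul_tmul, mul_one]
  rw [ExteriorAlgebra.ι_sq_zero, TensorProduct.tmul_zero]
lemma yy_cent (i j : Fin 4) : yg K i * yg K j ∈ Subring.center (FreeSuperComm K) := by
  rw [Subring.mem_center_iff]
  intro g
  simp only [yg, Algebra.TensorProduct.tmul_mul_tmul, mul_one]
  induction g using TensorProduct.induction_on with
  | zero => simp
  | tmul p w => rw [Algebra.TensorProduct.tmul_mul_tmul, Algebra.TensorProduct.tmul_mul_tmul, ea_comm, mul_one, one_mul]
  | add x y hx hy => rw [add_mul, mul_add, hx, hy]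
lemma xg_cent (i : Fin 4) : xg K i ∈ Subring.center (FreeSuperComm K) := by
  rw [Subring.mem_center_iff]
  intro g
  simp only [xg]
  induction g using TensorProduct.induction_on with
  | zero => simp
  | tmul p w => rw [Algebra.TensorProduct.tmul_mul_tmul, Algebra.TensorProduct.tmul_mul_tmul, mul_comm, mul_one, one_mul]
  | add x y hx hy => rw [add_mul, mul_add, hx, hy]

attribute [local instance] zalg

def ss : KP.Sup (Subring.center (FreeSuperComm K)) (FreeSuperComm K) where
  y1 := yg K 0
  y2 := yg K 2
  z1 := yg K 1
  z2 := yg K 3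
  e11 := ⟨_, yy_cent K 0 1⟩
  e12 := ⟨_, yy_cent K 0 3⟩
  e21 := ⟨_, yy_cent K 2 1⟩
  e22 := ⟨_, yy_cent K 2 3⟩
  x1 := ⟨_, xg_cent K 0⟩
  x1' := ⟨_, xg_cent K 1⟩
  x2 := ⟨_, xg_cent K 2⟩
  x2' := ⟨_, xg_cent K 3⟩
  y11 := yg_sq K _
  y22 := yg_sq K _
  z11 := yg_sq K _
  z22 := yg_sq K _
  y21 := yg_anti K _ _
  z21 := yg_anti K _ _
  zy11 := yg_anti K _ _
  zy12 := yg_anti K _ _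
  zy21 := yg_anti K _ _
  zy22 := yg_anti K _ _
  he11 := rfl
  he12 := rfl
  he21 := rfl
  he22 := rfl

lemma smul_c (z : Subring.center (FreeSuperComm K)) (r : FreeSuperComm K) : z • r = (z : FreeSuperComm K) * r := rfl

lemma C1_eq : genC₁ K = (ss K).D1 := by
  unfold genC₁ KP.Sup.D1 KP.Sup.mat
  simp only [smul_c, OneMemClass.coe_one, ZeroMemClass.coe_zero, one_mul, zero_mul, add_zero,
    zero_add, mul_one]
  rfl
lemma C2_eq : genC₂ K = (ss K).D2 := by
  unfold genC₂ KP.Sup.D2 KP.Sup.mat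
  simp only [smul_c, OneMemClass.coe_one, ZeroMemClass.coe_zero, one_mul, zero_mul, add_zero,
    zero_add, mul_one]
  rfl

lemma good (m) (hm : m ∈ Falg K) : (ss K).Good m := by
  unfold Falg at hm
  induction hm using Algebra.adjoin_induction with
  | mem x hx =>
    rcases hx with rfl | rfl
    · rw [C1_eq]; exact KP.Sup.Good.D1 _
    · rw [C2_eq]; exact KP.Sup.Good.D2 _
  | algebraMap r =>
    have h : algebraMap K (FreeSuperComm K) r ∈ Subring.center (FreeSuperComm K) := by
      rw [Subring.mem_center_iff]; intro g; exact (Algebra.commutes r g).symm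
    convert KP.Sup.Good.scal (ss K) ⟨_, h⟩ using 1
    unfold KP.Sup.mat
    ext i j; fin_cases i <;> fin_cases j <;> simp [smul_c, Matrix.algebraMap_matrix_apply]
  | add x y _ _ hx hy => exact hx.add hy
  | mul x y _ _ hx hy => exact hx.mul hy

lemma matcent (M : Matrix (Fin 2) (Fin 2) (FreeSuperComm K)) (hM : (ss K).Good M) :
   ((ss K).c0 * M * (ss K).c0 * genC₁ K = genC₁ K * ((ss K).c0 * M * (ss K).c0)) ∧ 
   ((ss K).c0 * M * (ss K).c0 * genC₂ K = genC₂ K * ((ss K).c0 * M * (ss K).c0)) ∧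
   (ss K).c0 * M * (ss K).c0 * (ss K).c0 = 0 := by
  obtain ⟨α, δ, g1, g2, k1, k2, l, n, r1, r2, hn, hr1, hr2, hD, hk1, hk2, rfl⟩ := hM
  rw [C1_eq, C2_eq]
  exact ⟨KP.Sup.c0_cent _ _ _ _ _ _ _, KP.Sup.c0_cent2 _ _ _ _ _ _ _, KP.Sup.c0_zero _ _ _ _ _ _ _⟩

def G1 : Falg K := ⟨genC₁ K, Algebra.subset_adjoin (by simp)⟩
def G2 : Falg K := ⟨genC₂ K, Algebra.subset_adjoin (by simp)⟩

lemma coe_br (a b : Falg K) : ((br a b : Falg K) : Matrix (Fin 2) (Fin 2) (FreeSuperComm K)) = br a.1 b.1 := rfl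

lemma brG : ((br (G1 K) (G2 K) : Falg K) : Matrix (Fin 2) (Fin 2) (FreeSuperComm K)) = (ss K).c0 := by
  rw [coe_br, ← KP.Sup.c0_eq, ← C1_eq, ← C2_eq]; rfl

lemma hs : Function.Surjective (FreeAlgebra.lift K ![G1 K, G2 K]) := by
  intro m
  obtain ⟨q, hq⟩ := KG.evC_surj K m.1 m.2
  refine ⟨q, ?_⟩
  have : (Falg K).val.comp (FreeAlgebra.lift K ![G1 K, G2 K]) = KG.evC K := by
    apply FreeAlgebra.hom_ext
    funext i
    fin_cases i <;> simp [KG.evC, G1, G2]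
  apply Subtype.ext
  rw [← hq, ← this]; rfl

lemma Fcent (a e : Falg K) : br (G1 K) (G2 K) * a * br (G1 K) (G2 K) * e =
    e * (br (G1 K) (G2 K) * a * br (G1 K) (G2 K)) := by
  obtain ⟨q, rfl⟩ := hs K e
  obtain ⟨h1, h2, -⟩ := matcent K a.1 (good K a.1 a.2)
  rw [← brG] at h1 h2
  induction q using FreeAlgebra.induction with
  | grade0 r => rw [AlgHom.commutes]; exact (Algebra.commutes r _).symm
  | grade1 i =>
    rw [FreeAlgebra.lift_ι_apply]
    apply Subtype.ext
    fin_cases i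
    · exact h1
    · exact h2
  | mul x y hx hy => rw [map_mul, ← mul_assoc, hx, mul_assoc, hy, ← mul_assoc]
  | add x y hx hy => rw [map_add, mul_add, add_mul, hx, hy]

lemma Fzero (a b : Falg K) : br (G1 K) (G2 K) * a * br (G1 K) (G2 K) * b * br (G1 K) (G2 K) = 0 := by
  rw [Fcent, mul_assoc]
  have : br (G1 K) (G2 K) * a * br (G1 K) (G2 K) * br (G1 K) (G2 K) = 0 := by
    obtain ⟨-, -, h3⟩ := matcent K a.1 (good K a.1 a.2)
    rw [← brG] at h3
    exact Subtype.ext h3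
  rw [this, mul_zero]

section abst
variable {K} {A : Type*} [Ring A] [Algebra K A] {t : Fin 2 → A}
  (hs : Function.Surjective (FreeAlgebra.lift K t))
include hs
lemma CCind {P : A → Prop} (h0 : P 0) (hadd : ∀ x y, P x → P y → P (x + y))
    (hsm : ∀ (k : K) x, P x → P (k • x))
    (hg : ∀ a b, P (a * br (t 0) (t 1) * b)) (a b : A) : P (br a b) := by
  have h := KZ.br_mem hs a b
  generalize br a b = v at h
  unfold KZ.CC at h
  induction h using Submodule.span_induction with
  | mem x hx =>
    obtain ⟨a, i, j, b, rfl⟩ := hx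
    fin_cases i <;> fin_cases j
    · simpa [br] using h0
    · exact hg a b
    · have := hsm (-1) _ (hg a b)
      convert this using 1
      rw [neg_smul, one_smul]
      simp [br]; noncomm_ring
    · simpa [br] using h0
  | zero => exact h0
  | add x y _ _ hx hy => exact hadd _ _ hx hy
  | smul k x _ hx => exact hsm k x hx

variable (Fcent : ∀ a e : A, br (t 0) (t 1) * a * br (t 0) (t 1) * e =
    e * (br (t 0) (t 1) * a * br (t 0) (t 1)))
  (Fzero : ∀ a b : A, br (t 0) (t 1) * a * br (t 0) (t 1) * b * br (t 0) (t 1) = 0)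
include Fzero
theorem F2' (a b c d e f : A) : br a b * br c d * br e f = 0 := by
  refine CCind hs (P := fun v => v * br c d * br e f = 0) ?_ ?_ ?_ ?_ a b
  · simp
  · intro x y hx hy
    rw [add_mul, add_mul, hx, hy, add_zero]
  · intro k x hx
    rw [smul_mul_assoc, smul_mul_assoc, hx, smul_zero]
  intro a b
  refine CCind hs (P := fun v => a * br (t 0) (t 1) * b * v * br e f = 0) ?_ ?_ ?_ ?_ c d
  · simp
  · intro x y hx hy
    rw [mul_add, add_mul, hx, hy, add_zero]
  · intro k x hx
    rw [mul_smul_comm, smul_mul_assoc, hx, smul_zero]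
  intro c d
  refine CCind hs (P := fun v => a * br (t 0) (t 1) * b * (c * br (t 0) (t 1) * d) * v = 0)
    ?_ ?_ ?_ ?_ e f
  · simp
  · intro x y hx hy
    rw [mul_add, hx, hy, add_zero]
  · intro k x hx
    rw [mul_smul_comm, hx, smul_zero]
  intro e f
  have h := congrArg (fun x => a * x * f) (Fzero (b * c) (d * e))
  simpa only [mul_assoc, zero_mul, mul_zero] using h

include Fcent
theorem F1' (a b c d e : A) : br (br a b * br c d) e = 0 := by
  refine CCind hs (P := fun v => br (v * br c d) e = 0) ?_ ?_ ?_ ?_ a b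
  · simp [br]
  · intro x y hx hy
    unfold br at *
    rw [add_mul, add_mul, mul_add, add_sub_add_comm, hx, hy, add_zero]
  · intro k x hx
    unfold br at *
    rw [smul_mul_assoc, smul_mul_assoc, mul_smul_comm, ← smul_sub, hx, smul_zero]
  intro a b
  refine CCind hs (P := fun v => br (a * br (t 0) (t 1) * b * v) e = 0) ?_ ?_ ?_ ?_ c d
  · simp [br]
  · intro x y hx hy
    unfold br at *
    rw [mul_add, add_mul, mul_add, add_sub_add_comm, hx, hy, add_zero]
  · intro k x hx
    unfold br at *
    rw [mul_smul_comm, smul_mul_assoc, mul_smul_comm, ← smul_sub, hx, smul_zero]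
  intro c d
  obtain ⟨z, hz⟩ : ∃ z, z = br (t 0) (t 1) * (b * c) * br (t 0) (t 1) := ⟨_, rfl⟩
  have hc : ∀ e, z * e = e * z := fun e => by rw [hz]; exact Fcent _ e
  have e1 : a * br (t 0) (t 1) * b * (c * br (t 0) (t 1) * d) = a * d * z := by
    rw [mul_assoc a d z, ← hc, hz]; simp only [mul_assoc]
  have e2 : br (a * d * z) e = br (a * d) e * z := by
    unfold br
    rw [mul_assoc (a * d), hc e, sub_mul]; simp only [mul_assoc]
  rw [e1, e2]
  refine CCind hs (P := fun v => v * z = 0) ?_ ?_ ?_ ?_ (a * d) e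
  · simp
  · intro x y hx hy
    rw [add_mul, hx, hy, add_zero]
  · intro k x hx
    rw [smul_mul_assoc, hx, smul_zero]
  intro p q
  have h := congrArg (fun x => p * x) (Fzero q (b * c))
  rw [hz]
  simpa only [mul_assoc, zero_mul, mul_zero] using h
end abst

theorem F1 (a b c d e : Falg K) : br (br a b * br c d) e = 0 :=
  F1' (hs K) (Fcent K) (Fzero K) a b c d e
theorem F2 (a b c d e f : Falg K) : br a b * br c d * br e f = 0 :=
  F2' (hs K) (Fzero K) a b c d e f

theorem F3 (a b c d : Falg K) : br a b * br c d + br c d * br a b - br a c * br b d - br b d * br a c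
    + br a d * br b c + br b c * br a d = 0 :=
  Subtype.ext (KP.Sup.Good.h3 (ss K) (good K a a.2) (good K b b.2) (good K c c.2) (good K d d.2))

end KH

end SecH

noncomputable section SecS
namespace KS
lemma sum_perm_succ {n : ℕ} {M : Type*} [AddCommGroup M] (f : Equiv.Perm (Fin (n+1)) → M) :
    ∑ σ, f σ = ∑ p : Fin (n+1), ∑ e : Equiv.Perm (Fin n), f (Equiv.Perm.decomposeFin.symm (p, e)) := by
  rw [← (Equiv.Perm.decomposeFin (n := n)).symm.sum_comp, Fintype.sum_prod_type]

lemma s4_map (K : Type*) [Field K] {B : Type*} [Ring B] [Algebra K B] (φ : FreeAlgebra K ℕ →ₐ[K] B) :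
    φ (s4poly K) =
    let a := φ (tv K 0); let b := φ (tv K 1); let c := φ (tv K 2); let d := φ (tv K 3)
    br a b * br c d + br c d * br a b - br a c * br b d - br b d * br a c
    + br a d * br b c + br b c * br a d := by
  unfold s4poly
  rw [map_sum]
  simp only [map_zsmul, map_mul]
  generalize φ ∘ tv K = t
  have h : ∀ f : ℕ → B, ∑ σ : Equiv.Perm (Fin 4), (Equiv.Perm.sign σ : ℤ) •
    (f (σ 0) * f (σ 1) * f (σ 2) * f (σ 3)) = br (f 0) (f 1) * br (f 2) (f 3) + br (f 2) (f 3) * br (f 0) (f 1) - br (f 0) (f 2) * br (f 1) (f 3) - br (f 1) (f 3) * br (f 0) (f 2)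
    + br (f 0) (f 3) * br (f 1) (f 2) + br (f 1) (f 2) * br (f 0) (f 3) := by
    intro f
    have key : ∀ p : Fin 4, ∀ q : Fin 3, ∀ r : Fin 2, ∀ e : Equiv.Perm (Fin 1),
      let σ := Equiv.Perm.decomposeFin.symm (p, Equiv.Perm.decomposeFin.symm (q,
        Equiv.Perm.decomposeFin.symm (r, e)))
      σ 0 = p ∧ σ 1 = Equiv.swap 0 p (Fin.succ q) ∧
        σ 2 = Equiv.swap 0 p (Fin.succ (Equiv.swap 0 q (Fin.succ r))) ∧
        σ 3 = Equiv.swap 0 p (Fin.succ (Equiv.swap 0 q (Fin.succ (Equiv.swap 0 r 1)))) ∧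
        (Equiv.Perm.sign σ : ℤ) = (if p = 0 then 1 else -1) * ((if q = 0 then 1 else -1) * (if r = 0 then 1 else -1)) := by
      decide
    rw [sum_perm_succ (n := 3)]
    simp only [sum_perm_succ (n := 2), sum_perm_succ (n := 1)]
    simp only [key]
    simp [Fin.sum_univ_succ, Equiv.swap_apply_def]
    unfold br
    noncomm_ring
  exact h fun n => φ (tv K n)
end KS

end SecS

noncomputable section SecFF
namespace KF
variable (K : Type*) [Field K]

abbrev II : TwoSidedIdeal (FreeAlgebra K ℕ) := TIdealGen K {p₁ K, p₂ K, s4poly K}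

lemma easy : (II K : Set (FreeAlgebra K ℕ)) ⊆ polyIdentities K (Falg K) := by
  intro f hf φ
  have h : II K ≤ TwoSidedIdeal.ker φ := by
    unfold II TIdealGen
    rw [TwoSidedIdeal.span_le]
    rintro _ ⟨p, hp, ψ, rfl⟩
    rw [SetLike.mem_coe, TwoSidedIdeal.mem_ker]
    rcases hp with rfl | rfl | rfl
    · simp only [p₁, br, map_mul, map_sub]
      exact KH.F1 K _ _ _ _ _
    · simp only [p₂, br, map_mul, map_sub]
      exact KH.F2 K _ _ _ _ _ _
    · have := KS.s4_map K (B := Falg K) (φ.comp ψ)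
      refine this.trans ?_
      exact KH.F3 K _ _ _ _
  exact (TwoSidedIdeal.mem_ker φ).1 (h hf)

abbrev AA := (II K).ringCon.Quotient
def mk : FreeAlgebra K ℕ →ₐ[K] AA K := RingCon.mkₐ K _
lemma mk_surj : Function.Surjective (mk K) := RingCon.mkₐ_surjective _
lemma mk_zero (f) : mk K f = 0 ↔ f ∈ II K := by
  rw [TwoSidedIdeal.mem_iff, ← RingCon.eq]; rfl

lemma gen_mem (p) (hp : p ∈ ({p₁ K, p₂ K, s4poly K} : Set (FreeAlgebra K ℕ))) (u : ℕ → AA K) :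
    FreeAlgebra.lift K u p = 0 := by
  choose w hw using mk_surj K
  have e : FreeAlgebra.lift K u = (mk K).comp (FreeAlgebra.lift K (fun n => w (u n))) := by
    apply FreeAlgebra.hom_ext; funext n; simp [hw]
  rw [e]
  refine (mk_zero K _).2 (TwoSidedIdeal.subset_span ⟨p, hp, _, rfl⟩)

lemma A1 (a b c d e : AA K) : br (br a b * br c d) e = 0 := by
  have := gen_mem K (p₁ K) (by simp) (fun n => if n = 0 then a else if n = 1 then b else if n = 2 then c
    else if n = 3 then d else e)
  simpa [p₁, br, tv] using this
lemma A2 (a b c d e f : AA K) : br a b * br c d * br e f = 0 := by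
  have := gen_mem K (p₂ K) (by simp) (fun n => if n = 0 then a else if n = 1 then b else if n = 2 then c
    else if n = 3 then d else if n = 4 then e else f)
  simpa [p₂, br, tv] using this
lemma A3 (a b c d : AA K) : br a b * br c d + br c d * br a b - br a c * br b d - br b d * br a c
    + br a d * br b c + br b c * br a d = 0 := by
  have := gen_mem K (s4poly K) (by simp) (fun n => if n = 0 then a else if n = 1 then b else if n = 2 then c
    else d)
  rw [KS.s4_map] at this
  simpa [tv] using this

def fin (n : ℕ) : FreeAlgebra K (Fin n) →ₐ[K] FreeAlgebra K ℕ :=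
  FreeAlgebra.lift K (fun i => tv K i)

lemma ex_fin (f : FreeAlgebra K ℕ) : ∃ n, ∀ m ≥ n, f ∈ (fin K m).range := by
  induction f using FreeAlgebra.induction with
  | grade0 r => exact ⟨0, fun m _ => Subalgebra.algebraMap_mem _ _⟩
  | grade1 i => exact ⟨i + 1, fun m hm => ⟨FreeAlgebra.ι K ⟨i, hm⟩, by simp [fin, tv]⟩⟩
  | mul x y hx hy =>
    obtain ⟨n, hn⟩ := hx
    obtain ⟨k, hk⟩ := hy
    exact ⟨max n k, fun m hm => mul_mem (hn m (le_trans (le_max_left _ _) hm))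
      (hk m (le_trans (le_max_right _ _) hm))⟩
  | add x y hx hy =>
    obtain ⟨n, hn⟩ := hx
    obtain ⟨k, hk⟩ := hy
    exact ⟨max n k, fun m hm => add_mem (hn m (le_trans (le_max_left _ _) hm))
      (hk m (le_trans (le_max_right _ _) hm))⟩

variable {n : ℕ}
def ext0 {M : Type*} [Zero M] (g : Fin n → M) (m : ℕ) : M := if h : m < n then g ⟨m, h⟩ else 0
lemma ext0_fin {M : Type*} [Zero M] (g : Fin n → M) (i : Fin n) : ext0 g i = g i := by
  simp [ext0]

def E0 (j l : Fin n) : FreeAlgebra K ℕ →ₐ[K] Matrix (Fin 3) (Fin 3) (KZ.PP K (Fin n)) :=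
  FreeAlgebra.lift K (fun m => !![ext0 (KZ.xx K) m, ext0 (fun i => KZ.dl K i j) m, 0;
    0, ext0 (fun i => KZ.xx K i - KZ.XX K i) m, ext0 (fun i => KZ.dl K i l) m;
    0, 0, ext0 (KZ.xx K) m])

lemma E0_T [Infinite K] (j l : Fin n) {f} (hf : f ∈ polyIdentities K (Falg K)) : E0 K j l f = 0 :=
  KG.TG K hf _ _ _ _

def E1 [Infinite K] (j l : Fin n) : AA K →ₐ[K] Matrix (Fin 3) (Fin 3) (KZ.PP K (Fin n)) :=
  RingCon.liftₐ _ (E0 K j l) (by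
    intro a b hab
    change E0 K j l a = E0 K j l b
    rw [← sub_eq_zero, ← map_sub]
    exact E0_T K j l (easy K ((TwoSidedIdeal.rel_iff _ _ _).1 hab)))

lemma E1_mk [Infinite K] (j l : Fin n) (f) : E1 K j l (mk K f) = E0 K j l f := rfl

theorem main [CharZero K] : polyIdentities K (Falg K) = (II K : Set (FreeAlgebra K ℕ)) := by
  refine Set.Subset.antisymm ?_ (easy K)
  intro f hf
  have : Infinite K := inferInstance
  obtain ⟨n, hn⟩ := ex_fin K f
  obtain ⟨g, hg⟩ := hn (n + 1) (Nat.le_succ n)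
  change fin K (n + 1) g = f at hg
  let Q : FreeAlgebra K (Fin (n+1)) →ₐ[K] AA K := (mk K).comp (fin K (n + 1))
  let t : Fin (n+1) → Q.range := fun i => Q.rangeRestrict (FreeAlgebra.ι K i)
  have ht : FreeAlgebra.lift K t = Q.rangeRestrict := by
    apply FreeAlgebra.hom_ext; funext i; simp [t]
  have key := KZ.core_thm (K := K) (t := t) (by rw [ht]; exact Q.rangeRestrict_surjective)
    (fun a b c d e => Subtype.ext (A1 K a b c d e))
    (fun a b c d e f => Subtype.ext (A2 K a b c d e f))
    (fun a b c d => Subtype.ext (A3 K a b c d))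
    (fun j l => (E1 K j l).comp Q.range.val)
    (by
      intro j l i
      change E1 K j l (mk K (fin K (n+1) (FreeAlgebra.ι K i))) = _
      rw [E1_mk]
      simp only [fin, E0, FreeAlgebra.lift_ι_apply, tv, ext0_fin]
      rfl)
    (Q.rangeRestrict g)
    (by
      intro j l
      change E1 K j l (mk K (fin K (n+1) g)) = _
      rw [hg, E1_mk]
      exact E0_T K j l hf)
  have h2 : mk K (fin K (n+1) g) = 0 := congrArg Subtype.val key
  rw [hg] at h2
  exact (mk_zero K f).1 h2
end KF

end SecFF

/- STATEMENT 5: T(F) is exactly the T-ideal generated by [[t1,t2][t3,t4],t5],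
[t1,t2][t3,t4][t5,t6] and s4(t1,t2,t3,t4). -/
theorem stmt5 (K : Type*) [Field K] [CharZero K] :
    polyIdentities K (Falg K) =
      (TIdealGen K {p₁ K, p₂ K, s4poly K} : Set (FreeAlgebra K ℕ)) := by
  exact KF.main K
end
end

section
/- Let A1 be the 5-dimensional subalgebra of the 3x3 upper triangular matrices over K consisting of all upper triangular matrices whose (1,1)-entry equals their (3,3)-entry. Then T(F) = T(A1); that is, the algebras F and A1 are PI equivalent (they satisfy the same polynomial identities). -/
open scoped TensorProduct

noncomputable section

/-- `A1`: the 5-dimensional subalgebra of the 3×3 upper triangular matrices over `K`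
consisting of the upper triangular matrices whose (1,1)-entry equals their (3,3)-entry. -/
def A1alg (K : Type*) [Field K] : Subalgebra K (Matrix (Fin 3) (Fin 3) K) where
  carrier := {A | A 1 0 = 0 ∧ A 2 0 = 0 ∧ A 2 1 = 0 ∧ A 0 0 = A 2 2}
  add_mem' := by
    rintro A B ⟨h1, h2, h3, h4⟩ ⟨g1, g2, g3, g4⟩
    refine ⟨?_, ?_, ?_, ?_⟩ <;> simp_all [Matrix.add_apply]
  mul_mem' := by
    rintro A B ⟨h1, h2, h3, h4⟩ ⟨g1, g2, g3, g4⟩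
    refine ⟨?_, ?_, ?_, ?_⟩ <;>
      simp_all [Matrix.mul_apply, Fin.sum_univ_three]
  algebraMap_mem' := by
    intro r
    refine ⟨?_, ?_, ?_, ?_⟩ <;> simp [Matrix.algebraMap_matrix_apply]

set_option linter.all false
set_option linter.unusedSimpArgs false

lemma vanish_comm {K : Type*} [Field K] [CharZero K] {Z : Type*} [CommRing Z] [Algebra K Z]
    (f : FreeAlgebra K ℕ) (hf : f ∈ polyIdentities K (A1alg K))
    (N : ℕ → Matrix (Fin 3) (Fin 3) Z)
    (h10 : ∀ i, N i 1 0 = 0) (h20 : ∀ i, N i 2 0 = 0) (h21 : ∀ i, N i 2 1 = 0)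
    (h02 : ∀ i, N i 0 0 = N i 2 2) : FreeAlgebra.lift K N f = 0 := by
  let X : ℕ → Fin 5 → MvPolynomial (ℕ × Fin 5) K := fun i k => MvPolynomial.X (i, k)
  let gen : ℕ → Matrix (Fin 3) (Fin 3) (MvPolynomial (ℕ × Fin 5) K) := fun i =>
    !![X i 0, X i 1, X i 2; 0, X i 3, X i 4; 0, 0, X i 0]
  have hgen : FreeAlgebra.lift K gen f = 0 := by
    apply Matrix.ext
    intro a b
    apply MvPolynomial.funext
    intro pt
    let g : ℕ → A1alg K := fun i =>
      ⟨!![pt (i, 0), pt (i, 1), pt (i, 2); 0, pt (i, 3), pt (i, 4); 0, 0, pt (i, 0)],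
        by refine ⟨?_, ?_, ?_, ?_⟩ <;> simp⟩
    have h1 := hf (FreeAlgebra.lift K g)
    have h2 : ((MvPolynomial.aeval pt).mapMatrix).comp (FreeAlgebra.lift K gen)
        = (A1alg K).val.comp (FreeAlgebra.lift K g) := by
      apply FreeAlgebra.hom_ext
      funext i
      ext a b
      fin_cases a <;> fin_cases b <;> simp [gen, g, X]
    have h3 := congrArg (fun M => M a b) (DFunLike.congr_fun h2 f)
    simp only [AlgHom.comp_apply, h1, map_zero] at h3
    simpa [MvPolynomial.aeval_eq_eval] using h3
  let e : ℕ × Fin 5 → Z := fun p => ![N p.1 0 0, N p.1 0 1, N p.1 0 2, N p.1 1 1, N p.1 1 2] p.2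
  have h2 : ((MvPolynomial.aeval (R := K) e).mapMatrix).comp (FreeAlgebra.lift K gen)
      = FreeAlgebra.lift K N := by
    apply FreeAlgebra.hom_ext
    funext i
    ext a b
    fin_cases a <;> fin_cases b <;> simp [gen, e, X, h10, h20, h21, h02]
  rw [← h2, AlgHom.comp_apply, hgen, map_zero]

/-- Compatible triples. -/
def Trip {K Z S : Type*} [Field K] [CommRing Z] [Algebra K Z] [Ring S] [Algebra K S]
    (c : Z →ₐ[K] S) (hc : ∀ z s, c z * s = s * c z) (H H' : S)
    (hH : H * H = 0) (hH' : H' * H' = 0) (hHH : H' * H = - (H * H')) :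
    Subalgebra K (Matrix (Fin 2) (Fin 2) S × Matrix (Fin 3) (Fin 3) Z ×
      Matrix (Fin 3) (Fin 3) Z) where
  carrier := {t |
    (t.2.1 1 0 = 0 ∧ t.2.1 2 0 = 0 ∧ t.2.1 2 1 = 0 ∧ t.2.1 0 0 = t.2.1 2 2) ∧
    (t.2.2 1 0 = 0 ∧ t.2.2 2 0 = 0 ∧ t.2.2 2 1 = 0 ∧ t.2.2 0 0 = t.2.2 2 2) ∧
    (t.2.2 0 0 = t.2.1 1 1 ∧ t.2.2 1 1 = t.2.1 0 0 ∧ t.2.2 0 1 = t.2.1 1 2 ∧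
      t.2.2 1 2 = t.2.1 0 1) ∧
    (t.1 0 0 = c (t.2.1 0 0) + c (t.2.1 0 2) * (H * H') ∧
     t.1 0 1 = c (t.2.1 0 1) * H ∧ t.1 1 0 = c (t.2.1 1 2) * H' ∧
     t.1 1 1 = c (t.2.1 1 1) + c (t.2.2 0 2) * (H' * H))}
  add_mem' := by
    rintro ⟨M, N, N'⟩ ⟨L, O, O'⟩ ⟨⟨a1, a2, a3, a4⟩, ⟨b1, b2, b3, b4⟩, ⟨c1, c2, c3, c4⟩,
      ⟨d1, d2, d3, d4⟩⟩ ⟨⟨e1, e2, e3, e4⟩, ⟨f1, f2, f3, f4⟩, ⟨g1, g2, g3, g4⟩,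
      ⟨i1, i2, i3, i4⟩⟩
    dsimp only at *
    refine ⟨⟨?_, ?_, ?_, ?_⟩, ⟨?_, ?_, ?_, ?_⟩, ⟨?_, ?_, ?_, ?_⟩, ⟨?_, ?_, ?_, ?_⟩⟩
    on_goal 9 => simp only [Prod.mk_add_mk, Matrix.add_apply, c1, g1]
    all_goals
      simp only [Prod.fst_add, Prod.snd_add, Prod.mk_add_mk, Matrix.add_apply, map_add, *,
        add_zero, add_mul] <;> abel
  mul_mem' := by
    rintro ⟨M, N, N'⟩ ⟨L, O, O'⟩ ⟨⟨a1, a2, a3, a4⟩, ⟨b1, b2, b3, b4⟩, ⟨c1, c2, c3, c4⟩,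
      ⟨d1, d2, d3, d4⟩⟩ ⟨⟨e1, e2, e3, e4⟩, ⟨f1, f2, f3, f4⟩, ⟨g1, g2, g3, g4⟩,
      ⟨i1, i2, i3, i4⟩⟩
    dsimp only at *
    have m : ∀ (p q : Z) (s t : S), (c p * s) * (c q * t) = c (p * q) * (s * t) := by
      intro p q s t
      rw [map_mul, mul_assoc, ← mul_assoc s, ← hc q s]; simp only [mul_assoc]
    have m1 : ∀ (p q : Z) (t : S), c p * (c q * t) = c (p * q) * t := by
      intro p q t
      rw [map_mul, mul_assoc]
    have m2 : ∀ (p q : Z) (s : S), (c p * s) * c q = c (p * q) * s := by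
      intro p q s
      rw [map_mul, mul_assoc, ← hc, mul_assoc]
    have k1 : (H * H') * H = 0 := by rw [mul_assoc, hHH, mul_neg, ← mul_assoc, hH]; simp
    have k2 : H * (H' * H) = 0 := by rw [← mul_assoc, k1]
    have k3 : (H' * H) * H' = 0 := by rw [hHH, neg_mul, mul_assoc, hH']; simp
    have k4 : H' * (H * H') = 0 := by rw [← mul_assoc, k3]
    have k5 : (H * H') * (H * H') = 0 := by rw [← mul_assoc, k1, zero_mul]
    have k6 : (H' * H) * (H' * H) = 0 := by rw [← mul_assoc, k3, zero_mul]
    refine ⟨⟨?_, ?_, ?_, ?_⟩, ⟨?_, ?_, ?_, ?_⟩, ⟨?_, ?_, ?_, ?_⟩, ⟨?_, ?_, ?_, ?_⟩⟩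
    · simp [Matrix.mul_apply, Fin.sum_univ_three, *]
    · simp [Matrix.mul_apply, Fin.sum_univ_three, *]
    · simp [Matrix.mul_apply, Fin.sum_univ_three, *]
    · simp [Matrix.mul_apply, Fin.sum_univ_three, *]
    · simp [Matrix.mul_apply, Fin.sum_univ_three, *]
    · simp [Matrix.mul_apply, Fin.sum_univ_three, *]
    · simp [Matrix.mul_apply, Fin.sum_univ_three, *]
    · simp [Matrix.mul_apply, Fin.sum_univ_three, b1, b2, b3, f1, f2, f3, ← b4, ← f4]
    · simp [Matrix.mul_apply, Fin.sum_univ_three, a1, a3, e1, e3, b1, b2, f1, f2, e2, c1, g1]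
    · simp [Matrix.mul_apply, Fin.sum_univ_three, b1, b3, f1, f3, a1, a2, e1, e2, f2, c2, g2]
    · simp [Matrix.mul_apply, Fin.sum_univ_three, a1, a2, e1, e2, f3, c1, g1, c2, g2, c3, g3, ← a4, ← e4]
    · simp [Matrix.mul_apply, Fin.sum_univ_three, b1, b2, f1, f2, e3, c1, g1, c2, g2, c4, g4, ← b4, ← f4]
    · simp only [Prod.mk_mul_mk, Matrix.mul_apply, Fin.sum_univ_three, Fin.sum_univ_two, d1, i1, d2, i3,
        mul_add, add_mul, m, m1, m2, k5, e1, e2, mul_zero, add_zero, ← e4, map_add, ← map_mul]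
      abel
    · simp only [Prod.mk_mul_mk, Matrix.mul_apply, Fin.sum_univ_three, Fin.sum_univ_two, d1, i2, d2, i4,
        mul_add, add_mul, m, m1, m2, k1, k2, e3, mul_zero, add_zero, map_add, ← map_mul]
    · simp only [Prod.mk_mul_mk, Matrix.mul_apply, Fin.sum_univ_three, Fin.sum_univ_two, d3, i1, d4, i3,
        mul_add, add_mul, m, m1, m2, k3, k4, a1, zero_mul, zero_add, mul_zero, add_zero, map_add, ← map_mul,
        ← e4]
      abel
    · simp only [Prod.mk_mul_mk, Matrix.mul_apply, Fin.sum_univ_three, Fin.sum_univ_two, d3, i2, d4, i4,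
        mul_add, add_mul, m, m1, m2, k6, a1, e3, mul_zero, zero_mul, zero_add, add_zero, map_add,
        ← map_mul, c1, g1, c3, g4, ← f4]
      abel
  algebraMap_mem' := by
    intro r
    refine ⟨⟨?_, ?_, ?_, ?_⟩, ⟨?_, ?_, ?_, ?_⟩, ⟨?_, ?_, ?_, ?_⟩, ⟨?_, ?_, ?_, ?_⟩⟩ <;>
      simp [Matrix.algebraMap_matrix_apply]

lemma dir1_abs {K S : Type*} [Field K] [CharZero K] [Ring S] [Algebra K S]
    (x y : Fin 4 → S) (di : S) (hx : ∀ i s, x i * s = s * x i)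
    (hdi : ∀ s, di * s = s * di) (hd : (x 0 - x 1) * di = 1)
    (hyc : ∀ i j s, (y i * y j) * s = s * (y i * y j))
    (hy0 : ∀ i, y i * y i = 0) (hya : ∀ i j, y i * y j = - (y j * y i))
    (f : FreeAlgebra K ℕ) (hf : f ∈ polyIdentities K (A1alg K))
    (M : ℕ → Matrix (Fin 2) (Fin 2) S)
    (hM : ∀ i, M i ∈ Algebra.adjoin K {!![x 0, y 0; y 1, x 1], !![x 2, y 2; y 3, x 3]}) :
    FreeAlgebra.lift K M f = 0 := by
  have mem : ∀ s : S, (∀ t, s * t = t * s) → s ∈ Subalgebra.center K S := by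
    intro s hs
    rw [Subalgebra.mem_center_iff]
    exact fun b => (hs b).symm
  set Z := Subalgebra.center K S with hZ
  have hc : ∀ (z : Z) (s : S), Z.val z * s = s * Z.val z := by
    intro z s
    exact (Subalgebra.mem_center_iff.1 z.2 s).symm
  have hxm : ∀ i, x i ∈ Z := fun i => mem _ (hx i)
  have hdm : di ∈ Z := mem _ hdi
  have hym : ∀ i j, y i * y j ∈ Z := fun i j => mem _ (hyc i j)
  obtain ⟨e, he⟩ : ∃ e, e = (x 2 - x 3) * di := ⟨_, rfl⟩
  have hem : e ∈ Z := he ▸ Z.mul_mem (Z.sub_mem (hxm _) (hxm _)) hdm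
  have hec : ∀ s, e * s = s * e := fun s => (Subalgebra.mem_center_iff.1 hem s).symm
  -- odd elements
  have hyy : ∀ i j, y i * y j * y i = 0 := fun i j => by
    rw [hya i j, neg_mul, mul_assoc, hy0]; simp
  have cc : ∀ (p q s t : S), (∀ r, q * r = r * q) → (p * s) * (q * t) = (p * q) * (s * t) := by
    intro p q s t hq
    rw [mul_assoc, ← mul_assoc s, ← hq s]; simp only [mul_assoc]
  obtain ⟨H, hHdef⟩ : ∃ H, H = y 2 - e * y 0 := ⟨_, rfl⟩
  obtain ⟨H', hHdef'⟩ : ∃ H, H = y 3 - e * y 1 := ⟨_, rfl⟩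
  have swap : ∀ i s, y i * (e * s) = e * (y i * s) := fun i s => by
    rw [← mul_assoc, ← hec, mul_assoc]
  have hH : H * H = 0 := by
    rw [hHdef]
    simp only [mul_sub, sub_mul, mul_assoc, swap, hy0, mul_zero]
    rw [hya 2 0]; simp
  have hH' : H' * H' = 0 := by
    rw [hHdef']
    simp only [mul_sub, sub_mul, mul_assoc, swap, hy0, mul_zero]
    rw [hya 3 1]; simp
  have hHH : H' * H = - (H * H') := by
    rw [hHdef, hHdef']
    simp only [mul_sub, sub_mul, mul_assoc, swap]
    rw [hya 3 2, hya 3 0, hya 1 2, hya 1 0]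
    simp only [mul_neg]; abel
  obtain ⟨s, hs⟩ : ∃ s, s = - (di * y 0) := ⟨_, rfl⟩
  obtain ⟨t, ht⟩ : ∃ t, t = di * y 1 := ⟨_, rfl⟩
  have swapd : ∀ i s, y i * (di * s) = di * (y i * s) := fun i s => by
    rw [← mul_assoc, ← hdi, mul_assoc]
  have swapx : ∀ i j s, y i * (x j * s) = x j * (y i * s) := fun i j s => by
    rw [← mul_assoc, ← hx, mul_assoc]
  have hst : s * t ∈ Z := by
    have : s * t = - (di * (di * (y 0 * y 1))) := by
      rw [hs, ht]; simp only [neg_mul, mul_assoc, swapd]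
    rw [this]
    exact Z.neg_mem (Z.mul_mem hdm (Z.mul_mem hdm (hym _ _)))
  have hts' : t * s = - (s * t) := by
    rw [hs, ht]; simp only [neg_mul, mul_neg, mul_assoc, swapd]; rw [hya 1 0]; simp
  have hts : t * s ∈ Z := hts' ▸ Z.neg_mem hst
  have hss : s * s = 0 := by
    rw [hs]; simp only [neg_mul, mul_neg, mul_assoc, swapd, hy0]; simp
  have htt : t * t = 0 := by
    rw [ht]; simp only [mul_assoc, swapd, hy0]; simp
  have sxs : ∀ i, s * y i * s = 0 := by
    intro i
    rw [hs]
    simp only [neg_mul, mul_neg, mul_assoc, swapd]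
    rw [← mul_assoc (y 0), hyy]; simp
  have txt : ∀ i, t * y i * t = 0 := by
    intro i
    rw [ht]
    simp only [mul_assoc, swapd]
    rw [← mul_assoc (y 1), hyy]; simp
  have sym : ∀ i, s * y i ∈ Z := fun i => by
    rw [hs, neg_mul, mul_assoc]; exact Z.neg_mem (Z.mul_mem hdm (hym _ _))
  have tym : ∀ i, t * y i ∈ Z := fun i => by
    rw [ht, mul_assoc]; exact (Z.mul_mem hdm (hym _ _))
  have ysm : ∀ i, y i * s ∈ Z := fun i => by
    rw [hs, mul_neg, swapd]; exact Z.neg_mem (Z.mul_mem hdm (hym _ _))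
  have ytm : ∀ i, y i * t ∈ Z := fun i => by
    rw [ht, swapd]; exact (Z.mul_mem hdm (hym _ _))
  have sxt : ∀ i, s * x i * t ∈ Z := fun i => by
    rw [← hx, mul_assoc]; exact Z.mul_mem (hxm i) hst
  have txs : ∀ i, t * x i * s ∈ Z := fun i => by
    rw [← hx, mul_assoc]; exact Z.mul_mem (hxm i) hts
  let P : Matrix (Fin 2) (Fin 2) S := !![1, s; t, 1]
  let Q : Matrix (Fin 2) (Fin 2) S := !![1 + s * t, -s; -t, 1 + t * s]
  have sts : s * t * s = 0 := by rw [mul_assoc, hts', mul_neg, ← mul_assoc, hss]; simp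
  have tst : t * s * t = 0 := by rw [hts', neg_mul, mul_assoc, htt]; simp
  have hPQ : P * Q = 1 := by
    ext a b
    fin_cases a <;> fin_cases b <;>
      simp [P, Q, Matrix.mul_apply, mul_add, ← mul_assoc, sts, tst]
  have hC : ∀ C : Matrix (Fin 2) (Fin 2) S, C * P = P * (Q * C * P) := by
    intro C; rw [← mul_assoc, ← mul_assoc, hPQ, one_mul]
  let T := Trip Z.val hc H H' hH hH' hHH
  let U : Subalgebra K (Matrix (Fin 2) (Fin 2) S) :=
    { carrier := {C | ∃ τ ∈ T, C * P = P * τ.1}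
      mul_mem' := by
        rintro A B ⟨τ, h, h'⟩ ⟨ρ, g, g'⟩
        refine ⟨τ * ρ, T.mul_mem h g, ?_⟩
        rw [mul_assoc, g', ← mul_assoc, h', mul_assoc]; rfl
      add_mem' := by
        rintro A B ⟨τ, h, h'⟩ ⟨ρ, g, g'⟩
        refine ⟨τ + ρ, T.add_mem h g, ?_⟩
        rw [add_mul, g', h', Prod.fst_add, mul_add]
      algebraMap_mem' := by
        intro r
        refine ⟨algebraMap K _ r, T.algebraMap_mem r, ?_⟩
        exact Algebra.commutes r P }
  have hU : ∀ C : Matrix (Fin 2) (Fin 2) S,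
      (∃ a b u v : Z, (Q * C * P) = !![(a : S), u * H; v * H', b]) → C ∈ U := by
    rintro C ⟨a, b, u, v, h⟩
    refine ⟨⟨Q * C * P, !![a, u, 0; 0, b, v; 0, 0, a], !![b, v, 0; 0, a, u; 0, 0, b]⟩, ?_, hC C⟩
    refine ⟨⟨?_, ?_, ?_, ?_⟩, ⟨?_, ?_, ?_, ?_⟩, ⟨?_, ?_, ?_, ?_⟩, ⟨?_, ?_, ?_, ?_⟩⟩ <;> simp [h]
  have hW : ∀ i j k l, ∃ a b : Z, Q * !![x k, y i; y j, x l] * P =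
      !![(a : S), (1 + s * t) * (y i + (x k - x l) * s);
        (1 + t * s) * (y j - (x k - x l) * t), (b : S)] := by
    intro i j k l
    refine ⟨⟨(1 + s * t) * (x k + y i * t) - (s * y j + s * x l * t), ?_⟩,
      ⟨(1 + t * s) * (y j * s + x l) - (t * y i + t * x k * s), ?_⟩, ?_⟩
    · exact Z.sub_mem (Z.mul_mem (Z.add_mem Z.one_mem hst) (Z.add_mem (hxm _) (ytm _)))
        (Z.add_mem (sym _) (sxt _))
    · exact Z.sub_mem (Z.mul_mem (Z.add_mem Z.one_mem hts) (Z.add_mem (ysm _) (hxm _)))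
        (Z.add_mem (tym _) (txs _))
    · have a1 : s * (t * (y i * t)) = s * (t * y i * t) := by simp only [mul_assoc]
      have a2 : t * (s * (y j * s)) = t * (s * y j * s) := by simp only [mul_assoc]
      have b1 : s * (y j * s) = 0 := by rw [← mul_assoc, sxs]
      have b2 : t * (y i * t) = 0 := by rw [← mul_assoc, txt]
      have b3 : s * (t * s) = 0 := by rw [← mul_assoc, sts]
      have b4 : t * (s * t) = 0 := by rw [← mul_assoc, tst]
      have s1 : ∀ i, s * x i = x i * s := fun i => (hx i s).symm
      have t1 : ∀ i, t * x i = x i * t := fun i => (hx i t).symm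
      have s2 : ∀ i r, s * (x i * r) = x i * (s * r) := fun i r => by
        rw [← mul_assoc, s1, mul_assoc]
      have t2 : ∀ i r, t * (x i * r) = x i * (t * r) := fun i r => by
        rw [← mul_assoc, t1, mul_assoc]
      ext a b
      fin_cases a <;> fin_cases b <;>
        simp [P, Q, Matrix.mul_apply, mul_add, add_mul, mul_sub, sub_mul, mul_assoc, b1, b2, b3, b4,
          s1, t1, s2, t2] <;> abel
  have h1 : !![x 0, y 0; y 1, x 1] ∈ U := by
    apply hU
    obtain ⟨a, b, h⟩ := hW 0 1 0 1
    refine ⟨a, b, 0, 0, ?_⟩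
    have e1 : y 0 + (x 0 - x 1) * s = 0 := by
      rw [hs, mul_neg, ← mul_assoc, hd, one_mul, add_neg_cancel]
    have e2 : y 1 - (x 0 - x 1) * t = 0 := by
      rw [ht, ← mul_assoc, hd, one_mul, sub_self]
    rw [h, e1, e2]
    simp
  have h2 : !![x 2, y 2; y 3, x 3] ∈ U := by
    apply hU
    obtain ⟨a, b, h⟩ := hW 2 3 2 3
    refine ⟨a, b, ⟨1 + s * t, Z.add_mem Z.one_mem hst⟩, ⟨1 + t * s, Z.add_mem Z.one_mem hts⟩, ?_⟩
    have e1 : y 2 + (x 2 - x 3) * s = H := by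
      rw [hs, mul_neg, ← mul_assoc, ← he, hHdef, sub_eq_add_neg]
    have e2 : y 3 - (x 2 - x 3) * t = H' := by
      rw [ht, ← mul_assoc, ← he, hHdef']
    rw [h, e1, e2]
  have hle : Algebra.adjoin K {!![x 0, y 0; y 1, x 1], !![x 2, y 2; y 3, x 3]} ≤ U := by
    apply Algebra.adjoin_le
    rintro C (rfl | rfl)
    · exact h1
    · exact h2
  choose τ hτ hτ' using fun i => hle (hM i)
  have key : ∀ g, FreeAlgebra.lift K M g * P = P * (FreeAlgebra.lift K τ g).1 := by
    intro g
    induction g using FreeAlgebra.induction with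
    | grade0 r => simpa using Algebra.commutes r P
    | grade1 i => simpa using hτ' i
    | mul a b ha hb => rw [map_mul, mul_assoc, hb, ← mul_assoc, ha, mul_assoc, map_mul]; rfl
    | add a b ha hb => rw [map_add, add_mul, hb, ha, map_add, Prod.fst_add, mul_add]
  have hTm : ∀ g, FreeAlgebra.lift K τ g ∈ T := by
    intro g
    induction g using FreeAlgebra.induction with
    | grade0 r => simpa using T.algebraMap_mem r
    | grade1 i => simpa using hτ i
    | mul a b ha hb => rw [map_mul]; exact T.mul_mem ha hb
    | add a b ha hb => rw [map_add]; exact T.add_mem ha hb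
  have n1 : (FreeAlgebra.lift K τ f).2.1 = 0 := by
    have := vanish_comm f hf (fun i => (τ i).2.1) (fun i => (hτ i).1.1) (fun i => (hτ i).1.2.1)
      (fun i => (hτ i).1.2.2.1) (fun i => (hτ i).1.2.2.2)
    rw [← this]
    have h : ((AlgHom.fst K _ _).comp (AlgHom.snd K _ _)).comp (FreeAlgebra.lift K τ) =
      FreeAlgebra.lift K (fun i => (τ i).2.1) := by
      apply FreeAlgebra.hom_ext; funext i; simp
    exact DFunLike.congr_fun h f
  have n2 : (FreeAlgebra.lift K τ f).2.2 = 0 := by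
    have := vanish_comm f hf (fun i => (τ i).2.2) (fun i => (hτ i).2.1.1)
      (fun i => (hτ i).2.1.2.1)
      (fun i => (hτ i).2.1.2.2.1) (fun i => (hτ i).2.1.2.2.2)
    rw [← this]
    have h : ((AlgHom.snd K _ _).comp (AlgHom.snd K _ _)).comp (FreeAlgebra.lift K τ) =
      FreeAlgebra.lift K (fun i => (τ i).2.2) := by
      apply FreeAlgebra.hom_ext; funext i; simp
    exact DFunLike.congr_fun h f
  obtain ⟨-, -, -, q1, q2, q3, q4⟩ := hTm f
  have n3 : (FreeAlgebra.lift K τ f).1 = 0 := by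
    rw [n1] at q1 q2 q3 q4
    rw [n2] at q4
    ext a b
    fin_cases a <;> fin_cases b
    · simpa using q1
    · simpa using q2
    · simpa using q3
    · simpa using q4
  calc FreeAlgebra.lift K M f = FreeAlgebra.lift K M f * P * Q := by rw [mul_assoc, hPQ, mul_one]
    _ = 0 := by rw [key, n3]; simp


lemma ext_central {K V : Type*} [Field K] [AddCommGroup V] [Module K V] (a b : V)
    (s : ExteriorAlgebra K V) :
    ExteriorAlgebra.ι K a * ExteriorAlgebra.ι K b * s =
      s * (ExteriorAlgebra.ι K a * ExteriorAlgebra.ι K b) := by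
  have sw : ∀ a b : V, ExteriorAlgebra.ι K a * ExteriorAlgebra.ι K b =
      - (ExteriorAlgebra.ι K b * ExteriorAlgebra.ι K a) := fun a b =>
    eq_neg_of_add_eq_zero_left (ExteriorAlgebra.ι_add_mul_swap a b)
  induction s using ExteriorAlgebra.induction with
  | algebraMap r => exact (Algebra.commutes r _).symm
  | ι v => rw [mul_assoc, sw b v, mul_neg, ← mul_assoc, sw a v, neg_mul, neg_neg, mul_assoc]
  | mul p q hp hq => rw [← mul_assoc, hp, mul_assoc, hq, mul_assoc]
  | add p q hp hq => rw [mul_add, add_mul, hp, hq]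

lemma dir1 {K : Type*} [Field K] [CharZero K] (f : FreeAlgebra K ℕ)
    (hf : f ∈ polyIdentities K (A1alg K)) : f ∈ polyIdentities K (Falg K) := by
  intro φ
  let A := MvPolynomial (Fin 4) K
  let L := FractionRing A
  let j : FreeSuperComm K →ₐ[K] L ⊗[K] ExteriorAlgebra K (Fin 4 → K) :=
    Algebra.TensorProduct.map (IsScalarTower.toAlgHom K A L) (AlgHom.id K _)
  have hj : Function.Injective j :=
    Module.Flat.rTensor_preserves_injective_linearMap
      (M := ExteriorAlgebra K (Fin 4 → K)) (IsScalarTower.toAlgHom K A L).toLinearMap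
      (IsFractionRing.injective A L)
  have hjm : Function.Injective (j.mapMatrix (m := Fin 2)) := by
    intro M N h
    ext a b
    exact hj (congrFun (congrFun h a) b)
  let X : Fin 4 → L := fun i => algebraMap A L (MvPolynomial.X i)
  have hX : X 0 - X 1 ≠ 0 := by
    rw [sub_ne_zero]
    intro h
    have h := IsFractionRing.injective A L h
    have := MvPolynomial.X_injective h
    simp at this
  have lc : ∀ (l : L) (s : L ⊗[K] ExteriorAlgebra K (Fin 4 → K)),
      (l ⊗ₜ[K] 1) * s = s * (l ⊗ₜ[K] 1) := by
    intro l s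
    induction s using TensorProduct.induction_on with
    | zero => simp
    | tmul p q => simp [mul_comm]
    | add p q hp hq => rw [mul_add, add_mul, hp, hq]
  have key := dir1_abs (K := K) (S := L ⊗[K] ExteriorAlgebra K (Fin 4 → K))
    (fun i => X i ⊗ₜ 1) (fun i => 1 ⊗ₜ (ExteriorAlgebra.ι K (Pi.single i 1)))
    ((X 0 - X 1)⁻¹ ⊗ₜ 1) (fun i s => lc _ s) (lc _)
    (by
      rw [← TensorProduct.sub_tmul, Algebra.TensorProduct.tmul_mul_tmul, mul_inv_cancel₀ hX, mul_one]
      rfl)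
    (by
      intro i k s
      rw [Algebra.TensorProduct.tmul_mul_tmul, mul_one]
      induction s using TensorProduct.induction_on with
      | zero => simp
      | tmul p q =>
        rw [Algebra.TensorProduct.tmul_mul_tmul, Algebra.TensorProduct.tmul_mul_tmul, ext_central,
          mul_one, one_mul]
      | add p q hp hq => rw [mul_add, add_mul, hp, hq])
    (by
      intro i
      rw [Algebra.TensorProduct.tmul_mul_tmul, ExteriorAlgebra.ι_sq_zero, TensorProduct.tmul_zero])
    (by
      intro i k
      rw [Algebra.TensorProduct.tmul_mul_tmul, Algebra.TensorProduct.tmul_mul_tmul,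
        eq_neg_of_add_eq_zero_left (ExteriorAlgebra.ι_add_mul_swap _ _), TensorProduct.tmul_neg])
    f hf (fun i => j.mapMatrix (φ (FreeAlgebra.ι K i)).1)
    (by
      intro i
      have h1 : (φ (FreeAlgebra.ι K i)).1 ∈ Algebra.adjoin K {genC₁ K, genC₂ K} :=
        (φ (FreeAlgebra.ι K i)).2
      have h2 := Subalgebra.mem_map.2 ⟨_, h1, (rfl : j.mapMatrix _ = _)⟩
      rw [AlgHom.map_adjoin, Set.image_pair] at h2
      convert h2 using 3
      · ext a b
        fin_cases a <;> fin_cases b <;> simp [genC₁, xg, yg, j, X] <;> rfl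
      · congr 1
        ext a b
        fin_cases a <;> fin_cases b <;> simp [genC₂, xg, yg, j, X] <;> rfl)
  have h2 : (j.mapMatrix.comp (Falg K).val).comp φ =
      FreeAlgebra.lift K (fun i => j.mapMatrix (φ (FreeAlgebra.ι K i)).1) := by
    apply FreeAlgebra.hom_ext; funext i; simp
  rw [← h2] at key
  apply Subtype.ext
  apply hjm
  rw [show (((0 : Falg K) : Falg K) : Matrix (Fin 2) (Fin 2) (FreeSuperComm K)) = 0 from rfl, map_zero]
  exact key

/-- The word polynomial used to reach an element of `A1`. -/
def hw {K A : Type*} [Field K] [Ring A] [Algebra K A] (B : Matrix (Fin 3) (Fin 3) K) (p q : A) : A :=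
  B 0 0 • p + B 1 1 • (1 - p) + B 0 1 • (p * q) + B 1 2 • (q * p) + B 0 2 • (p * q * q * p)

lemma hw_map {K A A' : Type*} [Field K] [Ring A] [Algebra K A] [Ring A'] [Algebra K A']
    (B : Matrix (Fin 3) (Fin 3) K) (p q : A) (g : A →ₐ[K] A') :
    g (hw B p q) = hw B (g p) (g q) := by
  simp [hw]

lemma hw_mem {K A : Type*} [Field K] [Ring A] [Algebra K A] (U : Subalgebra K A)
    (B : Matrix (Fin 3) (Fin 3) K) (p q : A) (hp : p ∈ U) (hq : q ∈ U) : hw B p q ∈ U := by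
  have := (hw B (⟨p, hp⟩ : U) ⟨q, hq⟩).2
  rwa [← Subalgebra.coe_val, hw_map] at this

lemma dir2 {K : Type*} [Field K] (f : FreeAlgebra K ℕ)
    (hf : f ∈ polyIdentities K (Falg K)) : f ∈ polyIdentities K (A1alg K) := by
  intro ψ
  let H : Matrix (Fin 4) (Fin 4) K := !![0,0,0,0; 1,0,0,0; 0,0,0,0; 0,0,1,0]
  let H' : Matrix (Fin 4) (Fin 4) K := !![0,0,0,0; 0,0,0,0; 1,0,0,0; 0,-1,0,0]
  have hH : H * H = 0 := by
    ext a b; fin_cases a <;> fin_cases b <;> simp [H, Matrix.mul_apply, Fin.sum_univ_four]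
  have hH' : H' * H' = 0 := by
    ext a b; fin_cases a <;> fin_cases b <;> simp [H', Matrix.mul_apply, Fin.sum_univ_four]
  have hHH : H' * H = - (H * H') := by
    ext a b; fin_cases a <;> fin_cases b <;> simp [H, H', Matrix.mul_apply, Fin.sum_univ_four]
  let c : K →ₐ[K] Matrix (Fin 4) (Fin 4) K := Algebra.ofId K _
  have hc : ∀ z s, c z * s = s * c z := fun z s => Algebra.commutes z s
  let ℓ : (Fin 4 → K) →ₗ[K] Matrix (Fin 4) (Fin 4) K :=
    (LinearMap.proj 2).smulRight H + (LinearMap.proj 3).smulRight H'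
  have hℓ : ∀ m, ℓ m * ℓ m = 0 := by
    intro m
    simp only [ℓ, LinearMap.add_apply, LinearMap.smulRight_apply, LinearMap.proj_apply, add_mul,
      mul_add, smul_mul_assoc, mul_smul_comm, hH, hH', hHH, smul_neg, smul_zero]
    rw [zero_add, add_zero, smul_neg, smul_comm (m 2) (m 3), neg_add_cancel]
  let σ : FreeSuperComm K →ₐ[K] Matrix (Fin 4) (Fin 4) K :=
    Algebra.TensorProduct.lift (c.comp (MvPolynomial.aeval ![1, 0, 0, 0]))
      (ExteriorAlgebra.lift K ⟨ℓ, hℓ⟩) (fun p q => hc _ _)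
  have hσx : ∀ i, σ (xg K i) = c ((![1, 0, 0, 0] : Fin 4 → K) i) := by
    intro i
    refine (Algebra.TensorProduct.lift_tmul _ _ _ _ _).trans ?_
    rw [map_one, mul_one, AlgHom.comp_apply, MvPolynomial.aeval_X]
  have hσy : ∀ i, σ (yg K i) = ℓ (Pi.single i 1) := by
    intro i
    refine (Algebra.TensorProduct.lift_tmul _ _ _ _ _).trans ?_
    rw [map_one, one_mul, ExteriorAlgebra.lift_ι_apply]
  let T := Trip c hc H H' hH hH' hHH
  let p : Matrix (Fin 2) (Fin 2) (Matrix (Fin 4) (Fin 4) K) × Matrix (Fin 3) (Fin 3) K ×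
      Matrix (Fin 3) (Fin 3) K :=
    ⟨σ.mapMatrix (genC₁ K), !![1,0,0; 0,0,0; 0,0,1], !![0,0,0; 0,1,0; 0,0,0]⟩
  let q : Matrix (Fin 2) (Fin 2) (Matrix (Fin 4) (Fin 4) K) × Matrix (Fin 3) (Fin 3) K ×
      Matrix (Fin 3) (Fin 3) K :=
    ⟨σ.mapMatrix (genC₂ K), !![0,1,0; 0,0,1; 0,0,0], !![0,1,0; 0,0,1; 0,0,0]⟩
  have hp : p ∈ T := by
    refine ⟨⟨?_, ?_, ?_, ?_⟩, ⟨?_, ?_, ?_, ?_⟩, ⟨?_, ?_, ?_, ?_⟩, ⟨?_, ?_, ?_, ?_⟩⟩ <;>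
      simp [p, genC₁, hσx, hσy, ℓ]
  have hq : q ∈ T := by
    refine ⟨⟨?_, ?_, ?_, ?_⟩, ⟨?_, ?_, ?_, ?_⟩, ⟨?_, ?_, ?_, ?_⟩, ⟨?_, ?_, ?_, ?_⟩⟩ <;>
      simp [q, genC₂, hσx, hσy, ℓ]
  let B : ℕ → Matrix (Fin 3) (Fin 3) K := fun i => (ψ (FreeAlgebra.ι K i)).1
  let C₁ : Falg K := ⟨genC₁ K, Algebra.subset_adjoin (by simp)⟩
  let C₂ : Falg K := ⟨genC₂ K, Algebra.subset_adjoin (by simp)⟩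
  let τ : FreeAlgebra K ℕ →ₐ[K] T :=
    FreeAlgebra.lift K (fun i => hw (B i) (⟨p, hp⟩ : T) ⟨q, hq⟩)
  have e1 : (σ.mapMatrix.comp (Falg K).val).comp (FreeAlgebra.lift K (fun i => hw (B i) C₁ C₂)) =
      ((AlgHom.fst K _ _).comp T.val).comp τ := by
    apply FreeAlgebra.hom_ext
    funext i
    simp only [Function.comp_apply, AlgHom.comp_apply, τ, FreeAlgebra.lift_ι_apply,
      AlgHom.coe_comp, hw_map]
    exact (hw_map (B i) C₁ C₂ (σ.mapMatrix.comp (Falg K).val)).trans rfl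
  have e2 : (A1alg K).val.comp ψ =
      (((AlgHom.fst K _ _).comp (AlgHom.snd K _ _)).comp T.val).comp τ := by
    apply FreeAlgebra.hom_ext
    funext i
    simp only [Function.comp_apply, AlgHom.comp_apply, τ, FreeAlgebra.lift_ι_apply,
      AlgHom.coe_comp, hw_map]
    obtain ⟨b1, b2, b3, b4⟩ := (ψ (FreeAlgebra.ι K i)).2
    change B i = hw (B i) !![1,0,0; 0,0,0; 0,0,1] !![0,1,0; 0,0,1; 0,0,0]
    change B i 1 0 = 0 at b1
    change B i 2 0 = 0 at b2
    change B i 2 1 = 0 at b3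
    change B i 0 0 = B i 2 2 at b4
    ext a b
    fin_cases a <;> fin_cases b <;>
      simp [hw, b1, b2, b3, b4, Matrix.mul_apply, Fin.sum_univ_three, Matrix.one_apply]
  have z1 : (τ f).1.1 = 0 := by
    have := DFunLike.congr_fun e1 f
    simp only [AlgHom.comp_apply] at this
    rw [hf, map_zero, map_zero] at this
    exact this.symm
  have z2 : (ψ f).1 = (τ f).1.2.1 := DFunLike.congr_fun e2 f
  obtain ⟨⟨b1, b2, b3, b4⟩, -, -, q1, q2, q3, q4⟩ := (τ f).2
  rw [z1] at q1 q2 q3 q4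
  rw [← z2] at q1 q2 q3 q4 b1 b2 b3 b4
  have r1 := congrFun (congrFun q1 0) 0
  have r2 := congrFun (congrFun q1 3) 0
  have r3 := congrFun (congrFun q2 1) 0
  have r4 := congrFun (congrFun q3 2) 0
  have r5 := congrFun (congrFun q4 0) 0
  simp [c, H, H', Algebra.ofId_apply, Matrix.algebraMap_matrix_apply, Matrix.mul_apply,
    Fin.sum_univ_four] at r1 r2 r3 r4 r5
  apply Subtype.ext
  ext a b
  fin_cases a <;> fin_cases b <;> simp_all

/- STATEMENT 6: T(F) = T(A1); the algebras F and A1 are PI equivalent. -/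
theorem stmt6 (K : Type*) [Field K] [CharZero K] :
    polyIdentities K (Falg K) = polyIdentities K (A1alg K) := by
  ext f
  exact ⟨dir2 f, dir1 f⟩
end
end
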